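/- arXiv:2502.10791 — 2 statements merged into one kernel-verified Lean document; each statement's English description precedes it below -/
import Mathlib

section
/- Let 2 ≤ k̄ ≤ L/2, let Q = Σ_{A∈P_Λ, Diag A ≤ k̄} q_A A satisfy [H,Q] = 0, and let A be a Pauli product with Diag A = k̄. If the Shiraishi shift S(A) does not exist, then q_A = 0; if S(A) exists, then q_{S(A)} = λ q_A for some nonzero constant λ (equal to ±J_y/J_x or ±J_x/J_y depending on the cases used in defining S(A)). -/
open Complex Matrix

/-- Sites of the `L × L` square lattice with periodic boundary conditions. -/
abbrev Site (L : ℕ) := ZMod L × ZMod L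

/-- A specification of a product of Pauli matrices: at each site either
`0` (no operator), `1` (`X`), `2` (`Y`) or `3` (`Z`). -/
abbrev PSpec (L : ℕ) := Site L → Fin 4

/-- Operators on the Hilbert space `⊗_{u ∈ Λ} ℂ²`. -/
abbrev Op (L : ℕ) := Matrix (Site L → Fin 2) (Site L → Fin 2) ℂ

/-- The Pauli matrices (`0` gives the identity). -/
noncomputable def pauli (w : Fin 4) : Matrix (Fin 2) (Fin 2) ℂ :=
  if w = 1 then !![0, 1; 1, 0]
  else if w = 2 then !![0, -Complex.I; Complex.I, 0]
  else if w = 3 then !![1, 0; 0, -1]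
  else 1

/-- The product of Pauli matrices specified by `σ`, as an operator (matrix)
on the full Hilbert space. -/
noncomputable def PauliOp (L : ℕ) [NeZero L] (σ : PSpec L) : Op L :=
  fun s t => ∏ u : Site L, pauli (σ u) (s u) (t u)

/-- `DiagBoundAt L σ a k` : every site `u` in the support of `σ` satisfies
`0 ≤ uₓ + u_y − a ≤ k − 1 (mod L)`. -/
def DiagBoundAt (L : ℕ) (σ : PSpec L) (a : ZMod L) (k : ℕ) : Prop :=
  ∀ u : Site L, σ u ≠ 0 → (u.1 + u.2 - a).val < k

/-- The diagonal length of a Pauli product. -/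
noncomputable def Diag (L : ℕ) (σ : PSpec L) : ℕ :=
  sInf {k | ∃ a : ZMod L, DiagBoundAt L σ a k}

/-- `X_u` as a Pauli-product specification. -/
def sigX (L : ℕ) (u : Site L) : PSpec L := fun v => if v = u then 1 else 0
/-- `Y_u` as a Pauli-product specification. -/
def sigY (L : ℕ) (u : Site L) : PSpec L := fun v => if v = u then 2 else 0
/-- `Z_u` as a Pauli-product specification. -/
def sigZ (L : ℕ) (u : Site L) : PSpec L := fun v => if v = u then 3 else 0
/-- A single-site Pauli operator `W_u` (`w ∈ {1,2,3}`). -/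
def sigW (L : ℕ) (u : Site L) (w : Fin 4) : PSpec L := fun v => if v = u then w else 0

/-- `X_u X_{u+eₓ}` as a Pauli-product specification. -/
def sigXX (L : ℕ) (u : Site L) : PSpec L :=
  fun v => if v = u then 1 else if v = u + (1, 0) then 1 else 0
/-- `Y_u Y_{u+e_y}` as a Pauli-product specification. -/
def sigYY (L : ℕ) (u : Site L) : PSpec L :=
  fun v => if v = u then 2 else if v = u + (0, 1) then 2 else 0

/-- The quantum compass Hamiltonian
`H = −Σ_u (Jx X_u X_{u+eₓ} + Jy Y_u Y_{u+e_y})`. -/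
noncomputable def Hcompass (L : ℕ) [NeZero L] (Jx Jy : ℝ) : Op L :=
  - ∑ u : Site L, ((Jx : ℂ) • PauliOp L (sigXX L u) + (Jy : ℂ) • PauliOp L (sigYY L u))

/-- The quantum compass Hamiltonian with a uniform magnetic field. -/
noncomputable def Hfield (L : ℕ) [NeZero L] (Jx Jy hx hy hz : ℝ) : Op L :=
  - ∑ u : Site L,
      ((Jx : ℂ) • PauliOp L (sigXX L u) + (Jy : ℂ) • PauliOp L (sigYY L u)
        + (hx : ℂ) • PauliOp L (sigX L u) + (hy : ℂ) • PauliOp L (sigY L u)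
        + (hz : ℂ) • PauliOp L (sigZ L u))

/-- The candidate conserved quantity `Q = Σ_σ q_σ σ`. -/
noncomputable def Qop (L : ℕ) [NeZero L] (q : PSpec L → ℂ) : Op L :=
  ∑ σ : PSpec L, q σ • PauliOp L σ

/-- Commutator of operators. -/
noncomputable def opComm (L : ℕ) [NeZero L] (A B : Op L) : Op L := A * B - B * A

/-- The coefficient `λ_{σ,τ}` of the Pauli product `τ` in the expansion
`[H, σ] = Σ_τ λ_{σ,τ} τ`, extracted via the (normalized) trace inner product. -/
noncomputable def lam (L : ℕ) [NeZero L] (H : Op L) (σ τ : PSpec L) : ℂ :=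
  Matrix.trace (PauliOp L τ * opComm L H (PauliOp L σ)) / (2 ^ Fintype.card (Site L))

/-- `u` is a top-right site of `σ` (relative to the witness `a` for diagonal
length `k`). -/
def IsTopRight (L : ℕ) (σ : PSpec L) (a : ZMod L) (k : ℕ) (u : Site L) : Prop :=
  σ u ≠ 0 ∧ (u.1 + u.2 - a).val = k - 1

/-- `u` is a bottom-left site of `σ` (relative to the witness `a`). -/
def IsBottomLeft (L : ℕ) (σ : PSpec L) (a : ZMod L) (u : Site L) : Prop :=
  σ u ≠ 0 ∧ (u.1 + u.2 - a).val = 0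

/-- Condition (1): `σ` has a unique top-right site `ū`, with
(1a) `σ_ū = X` and `ū − eₓ ∈ Supp σ`, or (1b) `σ_ū = Y` and `ū − e_y ∈ Supp σ`. -/
def Cond1 (L : ℕ) (σ : PSpec L) (a : ZMod L) (k : ℕ) : Prop :=
  ∃ ub : Site L, (∀ v : Site L, IsTopRight L σ a k v ↔ v = ub) ∧
    ((σ ub = 1 ∧ σ (ub - (1, 0)) ≠ 0) ∨ (σ ub = 2 ∧ σ (ub - (0, 1)) ≠ 0))

/-- Condition (2): `σ` has a unique bottom-left site `u̲`, with
(2a) `σ_u̲ = X` and `u̲ + eₓ ∈ Supp σ`, or (2b) `σ_u̲ = Y` and `u̲ + e_y ∈ Supp σ`. -/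
def Cond2 (L : ℕ) (σ : PSpec L) (a : ZMod L) : Prop :=
  ∃ lb : Site L, (∀ v : Site L, IsBottomLeft L σ a v ↔ v = lb) ∧
    ((σ lb = 1 ∧ σ (lb + (1, 0)) ≠ 0) ∨ (σ lb = 2 ∧ σ (lb + (0, 1)) ≠ 0))

/-- `ShiftRel L k σ σ'` : `σ` has diagonal length `k`, satisfies conditions (1)
and (2), and `σ'` is the Shiraishi shift `S(σ)`, obtained by first appending a
site at the top right (the product `B`) and then truncating the bottom-left site. -/
def ShiftRel (L : ℕ) [NeZero L] (k : ℕ) (σ σ' : PSpec L) : Prop :=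
  Diag L σ = k ∧ σ' ≠ 0 ∧
  ∃ a : ZMod L, DiagBoundAt L σ a k ∧
  ∃ ub lb : Site L,
    (∀ v : Site L, IsTopRight L σ a k v ↔ v = ub) ∧
    (∀ v : Site L, IsBottomLeft L σ a v ↔ v = lb) ∧
    ∃ B : Op L,
      ((σ ub = 1 ∧ σ (ub - (1, 0)) ≠ 0 ∧
          B = (-(1 / (2 * Complex.I))) • opComm L (PauliOp L (sigYY L ub)) (PauliOp L σ)) ∨
       (σ ub = 2 ∧ σ (ub - (0, 1)) ≠ 0 ∧
          B = (1 / (2 * Complex.I)) • opComm L (PauliOp L (sigXX L ub)) (PauliOp L σ))) ∧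
      ∃ ε : ℂ, (ε = 1 / (2 * Complex.I) ∨ ε = -(1 / (2 * Complex.I))) ∧
        ((σ lb = 1 ∧ σ (lb + (1, 0)) ≠ 0 ∧
            PauliOp L σ' = ε • opComm L (PauliOp L (sigXX L lb)) B) ∨
         (σ lb = 2 ∧ σ (lb + (0, 1)) ≠ 0 ∧
            PauliOp L σ' = ε • opComm L (PauliOp L (sigYY L lb)) B))

/-- The staircase sequence `u_j`: `u_j = u₁ + ((j−1)/2)(eₓ+e_y)` for odd `j`,
and `u_j = u₁ + (j/2)(eₓ+e_y) − e_y` for even `j`. -/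
def stair (L : ℕ) (u1 : Site L) (j : ℕ) : Site L :=
  if j % 2 = 1 then
    u1 + ((((j - 1) / 2 : ℕ) : ZMod L), (((j - 1) / 2 : ℕ) : ZMod L))
  else
    u1 + (((j / 2 : ℕ) : ZMod L), ((j / 2 : ℕ) : ZMod L)) - ((0 : ZMod L), (1 : ZMod L))

/-- The Pauli letter at the first (bottom-left) end of `C^k_j`. -/
def endL (j : ℕ) : Fin 4 := if j % 2 = 1 then 1 else 2

/-- The Pauli letter at the last (top-right) end of `C^k_j`. -/
def endR (k j : ℕ) : Fin 4 :=
  if k % 2 = 1 then (if j % 2 = 1 then 2 else 1)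
  else (if j % 2 = 1 then 1 else 2)

/-- The standard-form product `C^k_j` based at `u₁`: the appropriate end
letters at `u_j` and `u_{j+k−1}`, and `Z` at `u_{j+1}, …, u_{j+k−2}`. -/
def Cspec (L : ℕ) (k j : ℕ) (u1 : Site L) : PSpec L := fun v =>
  if v = stair L u1 j then endL j
  else if v = stair L u1 (j + k - 1) then endR k j
  else if v ∈ (Finset.Icc (j + 1) (j + k - 2)).image (stair L u1) then 3
  else 0

section

/-- Multiplication of Pauli letters up to a phase. -/
def letterMul (a b : Fin 4) : Fin 4 := a ^^^ b

/-- Two Pauli letters anticommute. -/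
def LetterAnti (a b : Fin 4) : Prop := a ≠ 0 ∧ b ≠ 0 ∧ a ≠ b

instance (a b : Fin 4) : Decidable (LetterAnti a b) := by unfold LetterAnti; infer_instance

/-- The phase in the product of two Pauli letters. -/
noncomputable def letterPhase (a b : Fin 4) : ℂ :=
  if LetterAnti a b then (if b = a + 1 ∨ (a = 3 ∧ b = 1) then Complex.I else -Complex.I) else 1

theorem pauli_mul (a b : Fin 4) :
    pauli a * pauli b = letterPhase a b • pauli (letterMul a b) := by
  fin_cases a <;> fin_cases b <;>
    simp [pauli, letterPhase, LetterAnti, letterMul, Matrix.one_fin_two]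

theorem letterPhase_ne_zero (a b : Fin 4) : letterPhase a b ≠ 0 := by
  unfold letterPhase; split_ifs <;> simp

theorem letterPhase_of_not_anti {a b : Fin 4} (h : ¬ LetterAnti a b) : letterPhase a b = 1 := by
  simp [letterPhase, h]

theorem letterPhase_of_anti {a b : Fin 4} (h : LetterAnti a b) :
    letterPhase a b = Complex.I ∨ letterPhase a b = -Complex.I := by
  unfold letterPhase; split_ifs <;> simp

theorem letterPhase_swap {a b : Fin 4} (h : LetterAnti a b) :
    letterPhase a b = -letterPhase b a := by
  revert h
  fin_cases a <;> fin_cases b <;> simp [letterPhase, LetterAnti]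

theorem LetterAnti.symm {a b : Fin 4} (h : LetterAnti a b) : LetterAnti b a :=
  ⟨h.2.1, h.1, h.2.2.symm⟩

theorem letterMul_eq_zero {a b : Fin 4} : letterMul a b = 0 ↔ a = b := by
  revert a b; decide

theorem zero_letterMul (a : Fin 4) : letterMul 0 a = a := by
  revert a; decide

theorem letterMul_comm (a b : Fin 4) : letterMul a b = letterMul b a := by
  revert a b; decide

theorem trace_pauli (a : Fin 4) : Matrix.trace (pauli a) = if a = 0 then 2 else 0 := by
  fin_cases a <;> simp [pauli, Matrix.trace_fin_two]

variable {L : ℕ} [NeZero L]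

theorem PauliOp_mul (σ τ : PSpec L) :
    PauliOp L σ * PauliOp L τ =
      (∏ u, letterPhase (σ u) (τ u)) • PauliOp L (fun u => letterMul (σ u) (τ u)) := by
  ext s t
  have h : ∀ u : Site L, letterPhase (σ u) (τ u) * pauli (letterMul (σ u) (τ u)) (s u) (t u) =
      ∑ j : Fin 2, pauli (σ u) (s u) j * pauli (τ u) j (t u) := by
    intro u
    rw [← Matrix.mul_apply, pauli_mul, Matrix.smul_apply, smul_eq_mul]
  simp only [Matrix.mul_apply, PauliOp, Matrix.smul_apply, smul_eq_mul, ← Finset.prod_mul_distrib,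
    h]
  rw [Finset.prod_univ_sum, Fintype.piFinset_univ]

theorem PauliOp_zero : PauliOp L 0 = 1 := by
  ext s t
  simp only [PauliOp, Pi.zero_apply, Matrix.one_apply]
  by_cases h : s = t
  · subst h
    rw [if_pos rfl]
    exact Finset.prod_eq_one fun u _ => by simp [pauli]
  · obtain ⟨u, hu⟩ := Function.ne_iff.mp h
    rw [if_neg h]
    exact Finset.prod_eq_zero (Finset.mem_univ u) (by simp [pauli, hu])

theorem PauliOp_mul_self (σ : PSpec L) : PauliOp L σ * PauliOp L σ = 1 := by
  have h1 : (fun u => letterMul (σ u) (σ u)) = (0 : PSpec L) := by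
    funext u; exact letterMul_eq_zero.mpr rfl
  have h2 : ∀ u, letterPhase (σ u) (σ u) = 1 := fun u =>
    letterPhase_of_not_anti fun h => h.2.2 rfl
  rw [PauliOp_mul, h1, PauliOp_zero]
  simp [h2]

theorem trace_PauliOp (σ : PSpec L) :
    Matrix.trace (PauliOp L σ) = if σ = 0 then 2 ^ Fintype.card (Site L) else 0 := by
  have h : Matrix.trace (PauliOp L σ) = ∏ u, Matrix.trace (pauli (σ u)) := by
    simp only [Matrix.trace, Matrix.diag_apply, PauliOp]
    rw [Finset.prod_univ_sum, Fintype.piFinset_univ]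
  rw [h]
  simp only [trace_pauli]
  split_ifs with h0
  · simp [h0, Finset.card_univ]
  · obtain ⟨u, hu⟩ := Function.ne_iff.mp h0
    exact Finset.prod_eq_zero (Finset.mem_univ u) (if_neg hu)

/-- The overlap of an operator with the candidate conserved quantity. -/
noncomputable def overlap (q : PSpec L → ℂ) (M : Op L) : ℂ := Matrix.trace (M * Qop L q)

theorem overlap_smul (q : PSpec L → ℂ) (c : ℂ) (M : Op L) :
    overlap q (c • M) = c * overlap q M := by
  simp [overlap]

theorem overlap_PauliOp (q : PSpec L → ℂ) (σ : PSpec L) :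
    overlap q (PauliOp L σ) = 2 ^ Fintype.card (Site L) * q σ := by
  have h : ∀ τ, Matrix.trace (PauliOp L σ * (q τ • PauliOp L τ)) =
      if τ = σ then 2 ^ Fintype.card (Site L) * q σ else 0 := by
    intro τ
    by_cases hτ : τ = σ
    · subst hτ
      rw [Matrix.mul_smul, PauliOp_mul_self, if_pos rfl, ← PauliOp_zero, Matrix.trace_smul,
        trace_PauliOp, if_pos rfl, smul_eq_mul, mul_comm]
    · rw [if_neg hτ, Matrix.mul_smul, PauliOp_mul, Matrix.trace_smul, Matrix.trace_smul,
        trace_PauliOp, if_neg, smul_zero, smul_zero]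
      intro h0
      exact hτ (funext fun u => (letterMul_eq_zero.mp (congrFun h0 u)).symm)
  rw [overlap, Qop, Finset.mul_sum, Matrix.trace_sum, Finset.sum_congr rfl fun τ _ => h τ]
  simp

/-- `M` is a nonzero multiple of the Pauli product `σ`. -/
def IsPauli (M : Op L) (σ : PSpec L) : Prop := ∃ z : ℂ, z ≠ 0 ∧ M = z • PauliOp L σ

theorem isPauli_PauliOp (σ : PSpec L) : IsPauli (PauliOp L σ) σ :=
  ⟨1, one_ne_zero, (one_smul _ _).symm⟩

theorem IsPauli.overlap_eq_zero {q : PSpec L → ℂ} {M : Op L} {σ : PSpec L} (h : IsPauli M σ) :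
    overlap q M = 0 ↔ q σ = 0 := by
  obtain ⟨z, hz, rfl⟩ := h
  simp [overlap_smul, overlap_PauliOp, hz]

theorem IsPauli.mul {M : Op L} {τ : PSpec L} (σ : PSpec L) (h : IsPauli M τ) :
    IsPauli (PauliOp L σ * M) (fun u => letterMul (σ u) (τ u)) := by
  obtain ⟨z, hz, rfl⟩ := h
  refine ⟨z * ∏ u, letterPhase (σ u) (τ u),
    mul_ne_zero hz (Finset.prod_ne_zero_iff.mpr fun u _ => letterPhase_ne_zero _ _), ?_⟩
  rw [Matrix.mul_smul, PauliOp_mul, smul_smul]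

theorem IsPauli.ne_zero {M : Op L} {σ : PSpec L} (h : IsPauli M σ) : M ≠ 0 := by
  obtain ⟨z, hz, rfl⟩ := h
  refine smul_ne_zero hz fun h0 => ?_
  have h1 := PauliOp_mul_self σ
  rw [h0, zero_mul] at h1
  exact zero_ne_one h1

theorem letterPhase_eq_sign_mul (a b : Fin 4) :
    letterPhase a b = (if LetterAnti a b then -1 else 1) * letterPhase b a := by
  split_ifs with h
  · rw [letterPhase_swap h, neg_one_mul]
  · rw [letterPhase_of_not_anti h, letterPhase_of_not_anti fun h' => h h'.symm, one_mul]

theorem IsPauli.mul_swap {M : Op L} {τ : PSpec L} (σ : PSpec L) (h : IsPauli M τ) :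
    PauliOp L σ * M =
      (∏ u, if LetterAnti (σ u) (τ u) then (-1 : ℂ) else 1) • (M * PauliOp L σ) := by
  obtain ⟨z, -, rfl⟩ := h
  have h1 : (fun u => letterMul (σ u) (τ u)) = fun u => letterMul (τ u) (σ u) :=
    funext fun u => letterMul_comm _ _
  have h2 : ∏ u, letterPhase (σ u) (τ u) =
      (∏ u, if LetterAnti (σ u) (τ u) then (-1 : ℂ) else 1) * ∏ u, letterPhase (τ u) (σ u) := by
    rw [← Finset.prod_mul_distrib]
    exact Finset.prod_congr rfl fun u _ => letterPhase_eq_sign_mul _ _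
  rw [Matrix.mul_smul, Matrix.smul_mul, PauliOp_mul, PauliOp_mul, h1, h2, smul_smul, smul_smul,
    smul_smul]
  congr 1
  ring

end

section

variable {L : ℕ}

/-- The lattice vector of a bond type: `eₓ` for `true` and `e_y` for `false`. -/
def stepVec (L : ℕ) (t : Bool) : Site L := if t then (1, 0) else (0, 1)

/-- The Pauli letter of a bond type: `X` for `true` and `Y` for `false`. -/
def bondLetter (t : Bool) : Fin 4 := if t then 1 else 2

/-- The two-site interaction term attached to a bond. -/
def bondSpec (b : Bool × Site L) : PSpec L := fun v =>
  if v = b.2 then bondLetter b.1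
  else if v = b.2 + stepVec L b.1 then bondLetter b.1 else 0

/-- The Pauli product, up to a phase, of a bond term with `τ`. -/
def bondMul (b : Bool × Site L) (τ : PSpec L) : PSpec L := fun v =>
  letterMul (bondSpec b v) (τ v)

/-- The bond term anticommutes with `τ`. -/
def BondAnti (b : Bool × Site L) (τ : PSpec L) : Prop :=
  ¬ (LetterAnti (bondLetter b.1) (τ b.2) ↔
    LetterAnti (bondLetter b.1) (τ (b.2 + stepVec L b.1)))

theorem bondLetter_ne_zero (t : Bool) : bondLetter t ≠ 0 := by
  revert t; decide

theorem not_letterAnti_self (a : Fin 4) : ¬ LetterAnti a a := fun h => h.2.2 rfl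

theorem not_letterAnti_zero (a : Fin 4) : ¬ LetterAnti a 0 := fun h => h.2.1 rfl

theorem not_zero_letterAnti (a : Fin 4) : ¬ LetterAnti 0 a := fun h => h.1 rfl

theorem letterAnti_letterMul {a b : Fin 4} : LetterAnti a (letterMul a b) ↔ LetterAnti a b := by
  revert a b; decide

theorem LetterAnti.letterMul_ne_zero {a b : Fin 4} (h : LetterAnti a b) :
    letterMul a b ≠ 0 := fun h0 => h.2.2 (letterMul_eq_zero.mp h0)

theorem bondLetter_inj {s t : Bool} : bondLetter s = bondLetter t ↔ s = t := by
  revert s t; decide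

theorem exists_letterAnti_bondLetter {a : Fin 4} (h : a ≠ 0) :
    ∃ t, LetterAnti (bondLetter t) a := by
  revert a; decide

theorem letterAnti_bondLetter_not (t : Bool) : LetterAnti (bondLetter t) (bondLetter (!t)) := by
  revert t; decide

theorem letterMul_bondLetter_not (t : Bool) :
    letterMul (bondLetter t) (bondLetter (!t)) = 3 := by
  revert t; decide

theorem letterMul_bondLetter_not' (t : Bool) :
    letterMul (bondLetter (!t)) (bondLetter t) = 3 := by
  revert t; decide

theorem letterMul_bondLetter_three (t : Bool) :
    letterMul (bondLetter t) 3 = bondLetter (!t) := by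
  revert t; decide

theorem letterAnti_bondLetter_three (t : Bool) : LetterAnti (bondLetter t) 3 := by
  revert t; decide

theorem bondLetter_ne_three (t : Bool) : bondLetter t ≠ 3 := by
  revert t; decide

theorem zmod_one_ne_zero (hL : 1 < L) : (1 : ZMod L) ≠ 0 := by
  have : Fact (1 < L) := ⟨hL⟩
  exact one_ne_zero

theorem stepVec_ne_zero (hL : 1 < L) (t : Bool) : stepVec L t ≠ 0 := by
  have := zmod_one_ne_zero hL
  cases t <;> simp [stepVec, Prod.ext_iff, this]

theorem stepVec_injective (hL : 1 < L) {s t : Bool} (h : stepVec L s = stepVec L t) : s = t := by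
  have := zmod_one_ne_zero hL
  cases s <;> cases t <;> simp_all [stepVec, Prod.ext_iff]

theorem bondMul_left (b : Bool × Site L) (τ : PSpec L) :
    bondMul b τ b.2 = letterMul (bondLetter b.1) (τ b.2) := by
  simp [bondMul, bondSpec]

theorem bondMul_right (b : Bool × Site L) (τ : PSpec L) :
    bondMul b τ (b.2 + stepVec L b.1) =
      letterMul (bondLetter b.1) (τ (b.2 + stepVec L b.1)) := by
  simp [bondMul, bondSpec]

theorem bondMul_of_ne {b : Bool × Site L} {τ : PSpec L} {v : Site L} (h1 : v ≠ b.2)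
    (h2 : v ≠ b.2 + stepVec L b.1) : bondMul b τ v = τ v := by
  simp [bondMul, bondSpec, h1, h2, zero_letterMul]

theorem eq_or_eq_of_bondMul_eq_zero {b : Bool × Site L} {τ : PSpec L} {v : Site L}
    (h : bondMul b τ v = 0) (hv : τ v ≠ 0) :
    τ v = bondLetter b.1 ∧ (v = b.2 ∨ v = b.2 + stepVec L b.1) := by
  have h1 := (letterMul_eq_zero.mp h).symm
  unfold bondSpec at h1
  split_ifs at h1 with h2 h3
  · exact ⟨h1, Or.inl h2⟩
  · exact ⟨h1, Or.inr h3⟩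
  · exact absurd h1 hv

theorem bondAnti_bondMul {b : Bool × Site L} {τ : PSpec L} :
    BondAnti b (bondMul b τ) ↔ BondAnti b τ := by
  unfold BondAnti
  rw [bondMul_left, bondMul_right, letterAnti_letterMul, letterAnti_letterMul]

theorem diag_le {σ : PSpec L} {a : ZMod L} {k : ℕ} (h : DiagBoundAt L σ a k) : Diag L σ ≤ k :=
  Nat.sInf_le ⟨a, h⟩

variable [NeZero L]

theorem bond_sign (hL : 1 < L) (b : Bool × Site L) (τ : PSpec L) :
    (∏ u, if LetterAnti (bondSpec b u) (τ u) then (-1 : ℂ) else 1) =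
      (if LetterAnti (bondLetter b.1) (τ b.2) then -1 else 1) *
        (if LetterAnti (bondLetter b.1) (τ (b.2 + stepVec L b.1)) then -1 else 1) := by
  have hne : b.2 ≠ b.2 + stepVec L b.1 := fun h =>
    stepVec_ne_zero hL b.1 (left_eq_add.mp h)
  rw [Finset.prod_eq_mul b.2 (b.2 + stepVec L b.1) hne]
  · simp [bondSpec]
  · rintro c - ⟨h1, h2⟩
    simp [bondSpec, h1, h2, not_zero_letterAnti]
  · simp
  · simp

/-- The operator of a bond term. -/
noncomputable abbrev bondOp (b : Bool × Site L) : Op L := PauliOp L (bondSpec b)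

theorem bondOp_mul_self (b : Bool × Site L) : bondOp b * bondOp b = 1 := PauliOp_mul_self _

theorem IsPauli.bondOp_mul {M : Op L} {τ : PSpec L} (b : Bool × Site L) (h : IsPauli M τ) :
    IsPauli (bondOp b * M) (bondMul b τ) := h.mul _

theorem BondAnti.anticomm (hL : 1 < L) {b : Bool × Site L} {M : Op L} {τ : PSpec L}
    (h : BondAnti b τ) (hM : IsPauli M τ) : bondOp b * M = -(M * bondOp b) := by
  rw [bondOp, hM.mul_swap, bond_sign hL]
  unfold BondAnti at h
  split_ifs <;> simp_all

theorem commute_of_not_bondAnti (hL : 1 < L) {b : Bool × Site L} {M : Op L} {τ : PSpec L}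
    (h : ¬ BondAnti b τ) (hM : IsPauli M τ) : bondOp b * M = M * bondOp b := by
  rw [bondOp, hM.mul_swap, bond_sign hL]
  unfold BondAnti at h
  split_ifs <;> simp_all

theorem opComm_of_anticomm {A B : Op L} (h : A * B = -(B * A)) :
    opComm L A B = (2 : ℂ) • (A * B) := by
  rw [opComm, two_smul, sub_eq_add_neg, ← h]

theorem opComm_bond_mul (hL : 1 < L) {b : Bool × Site L} {M : Op L} {τ : PSpec L}
    (h : BondAnti b τ) (hM : IsPauli M τ) :
    opComm L (bondOp b) (bondOp b * M) = (2 : ℂ) • M := by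
  rw [opComm_of_anticomm ((bondAnti_bondMul.mpr h).anticomm hL (hM.bondOp_mul b)), ← mul_assoc,
    bondOp_mul_self, one_mul]

/-- The position of the antidiagonal through `v`, counted from `a`. -/
def pos (a : ZMod L) (v : Site L) : ℕ := (v.1 + v.2 - a).val

theorem pos_lt (a : ZMod L) (v : Site L) : pos a v < L := ZMod.val_lt _

theorem val_add_one_cases (hL : 1 < L) (x : ZMod L) :
    (x.val + 1 < L ∧ (x + 1).val = x.val + 1) ∨ (x.val + 1 = L ∧ (x + 1).val = 0) := by
  have h := ZMod.val_lt x
  rw [ZMod.val_add, ZMod.val_one'' (by lia)]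
  rcases Nat.lt_or_ge (x.val + 1) L with h1 | h1
  · exact Or.inl ⟨h1, Nat.mod_eq_of_lt h1⟩
  · have h2 : x.val + 1 = L := by lia
    exact Or.inr ⟨h2, by rw [h2, Nat.mod_self]⟩

theorem pos_add_stepVec (hL : 1 < L) (a : ZMod L) (v : Site L) (t : Bool) :
    (pos a v + 1 < L ∧ pos a (v + stepVec L t) = pos a v + 1) ∨
      (pos a v + 1 = L ∧ pos a (v + stepVec L t) = 0) := by
  have h : (v + stepVec L t).1 + (v + stepVec L t).2 - a = v.1 + v.2 - a + 1 := by
    cases t <;> simp [stepVec] <;> ring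
  unfold pos
  rw [h]
  exact val_add_one_cases hL _

theorem pos_sub_stepVec (hL : 1 < L) (a : ZMod L) (v : Site L) (t : Bool) :
    (1 ≤ pos a v ∧ pos a (v - stepVec L t) = pos a v - 1) ∨
      (pos a v = 0 ∧ pos a (v - stepVec L t) = L - 1) := by
  have h := pos_add_stepVec hL a (v - stepVec L t) t
  rw [sub_add_cancel] at h
  lia

theorem pos_add_one (hL : 1 < L) (a : ZMod L) (v : Site L) :
    (1 ≤ pos a v ∧ pos (a + 1) v = pos a v - 1) ∨ (pos a v = 0 ∧ pos (a + 1) v = L - 1) := by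
  have h := val_add_one_cases hL (v.1 + v.2 - (a + 1))
  have h1 : v.1 + v.2 - (a + 1) + 1 = v.1 + v.2 - a := by ring
  rw [h1] at h
  unfold pos
  lia

theorem pos_sub_one (hL : 1 < L) (a : ZMod L) (v : Site L) :
    (pos a v + 1 < L ∧ pos (a - 1) v = pos a v + 1) ∨
      (pos a v + 1 = L ∧ pos (a - 1) v = 0) := by
  have h := pos_add_one hL (a - 1) v
  have h2 := pos_lt a v
  have h3 := pos_lt (a - 1) v
  rw [sub_add_cancel] at h
  lia

theorem pos_change {a : ZMod L} {v w : Site L} (hv : pos a v = 0) (a' : ZMod L) :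
    pos a' w = (pos a' v + pos a w) % L := by
  have h0 : v.1 + v.2 - a = 0 := (ZMod.val_eq_zero _).mp hv
  have h1 : w.1 + w.2 - a' = (v.1 + v.2 - a') + (w.1 + w.2 - a) := by
    linear_combination -h0
  unfold pos
  rw [h1, ZMod.val_add]

theorem exists_diagBoundAt (σ : PSpec L) : ∃ a, DiagBoundAt L σ a (Diag L σ) :=
  Nat.sInf_mem (s := {k | ∃ a, DiagBoundAt L σ a k}) ⟨L, 0, fun _ _ => ZMod.val_lt _⟩

theorem lt_diag_of_ends {σ : PSpec L} {a : ZMod L} {m : ℕ} {v w : Site L} (hv : σ v ≠ 0)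
    (hv0 : pos a v = 0) (hw : σ w ≠ 0) (hwm : pos a w = m) (hm : 2 * m ≤ L) :
    m < Diag L σ := by
  by_contra! hle
  obtain ⟨a', h⟩ := exists_diagBoundAt σ
  have h1 : pos a' v < Diag L σ := h v hv
  have h2 : pos a' w < Diag L σ := h w hw
  rw [pos_change hv0, hwm] at h2
  rcases Nat.lt_or_ge (pos a' v + m) L with h3 | h3
  · rw [Nat.mod_eq_of_lt h3] at h2
    lia
  · lia

/-- The support of `σ` has first antidiagonal `a` and diagonal length exactly `k`. -/
structure Window (a : ZMod L) (k : ℕ) (σ : PSpec L) : Prop where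
  lt : ∀ v, σ v ≠ 0 → pos a v < k
  bot : ∃ v, σ v ≠ 0 ∧ pos a v = 0
  top : ∃ v, σ v ≠ 0 ∧ pos a v = k - 1

theorem window_of_diagBoundAt (hL : 1 < L) {σ : PSpec L} {a : ZMod L} {k : ℕ} (hk : 2 ≤ k)
    (hd : Diag L σ = k) (h : DiagBoundAt L σ a k) : Window a k σ := by
  refine ⟨h, ?_, ?_⟩
  · by_contra! hn
    have h1 : DiagBoundAt L σ (a + 1) (k - 1) := by
      intro v hv
      have h2 : pos a v < k := h v hv
      have h3 := hn v hv
      have h4 := pos_add_one hL a v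
      change pos (a + 1) v < k - 1
      lia
    have := diag_le h1
    lia
  · by_contra! hn
    have h1 : DiagBoundAt L σ a (k - 1) := by
      intro v hv
      have h2 : pos a v < k := h v hv
      have h3 := hn v hv
      change pos a v < k - 1
      lia
    have := diag_le h1
    lia

theorem window_of_ends (hL : 1 < L) {σ : PSpec L} {a : ZMod L} {k : ℕ} (hk : 2 ≤ k)
    (hkL : 2 * k ≤ L) (hd : Diag L σ ≤ k) {v w : Site L} (hv : σ v ≠ 0)
    (hv0 : pos a v = 0) (hw : σ w ≠ 0) (hwk : pos a w = k - 1) : Window a k σ := by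
  have h1 := lt_diag_of_ends hv hv0 hw hwk (by lia)
  have hdk : Diag L σ = k := by lia
  obtain ⟨a', h⟩ := exists_diagBoundAt σ
  rw [hdk] at h
  have h2 : pos a' v < k := h v hv
  have h3 : pos a' w < k := h w hw
  rw [pos_change hv0, hwk, Nat.mod_eq_of_lt (by lia)] at h3
  have h4 : pos a' v = 0 := by lia
  have h5 : a' = a := by
    have h6 : v.1 + v.2 - a = 0 := (ZMod.val_eq_zero _).mp hv0
    have h7 : v.1 + v.2 - a' = 0 := (ZMod.val_eq_zero _).mp h4
    linear_combination h6 - h7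
  rw [h5] at h
  exact window_of_diagBoundAt hL hk hdk h

end

section

variable {L : ℕ} [NeZero L]

/-- An anticommuting bond that erases the first antidiagonal of `τ` attaches the only site there
to the next antidiagonal. -/
theorem bond_of_clears_bot (hL : 1 < L) {a : ZMod L} {m : ℕ} (hm : m + 1 < L) {τ : PSpec L}
    (hlt : ∀ v, τ v ≠ 0 → pos a v ≤ m) {x : Site L} (hx : τ x ≠ 0) (hx0 : pos a x = 0)
    {b : Bool × Site L} (hb : BondAnti b τ) (hclr : ∀ v, pos a v = 0 → bondMul b τ v = 0) :
    b.2 = x ∧ τ x = bondLetter b.1 ∧ LetterAnti (bondLetter b.1) (τ (x + stepVec L b.1)) ∧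
      ∀ v, τ v ≠ 0 → pos a v = 0 → v = x := by
  have key : ∀ v, τ v ≠ 0 → pos a v = 0 → τ v = bondLetter b.1 ∧ v = b.2 := by
    intro v hv hv0
    obtain ⟨h1, h2 | h2⟩ := eq_or_eq_of_bondMul_eq_zero (hclr v hv0) hv
    · exact ⟨h1, h2⟩
    · exfalso
      have h3 := pos_add_stepVec hL a b.2 b.1
      rw [← h2, hv0] at h3
      have h4 : τ b.2 = 0 := by
        by_contra h4
        have := hlt _ h4
        lia
      unfold BondAnti at hb
      rw [← h2, h1, h4] at hb
      simp [not_letterAnti_self, not_letterAnti_zero] at hb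
  obtain ⟨h1, rfl⟩ := key x hx hx0
  refine ⟨rfl, h1, ?_, fun v hv hv0 => (key v hv hv0).2⟩
  unfold BondAnti at hb
  rw [h1] at hb
  simpa [not_letterAnti_self] using hb

/-- An anticommuting bond that erases the last antidiagonal of `τ` attaches the only site there
to the previous antidiagonal. -/
theorem bond_of_clears_top (hL : 1 < L) {a : ZMod L} {m : ℕ} (hm : m + 1 < L) {τ : PSpec L}
    (hlt : ∀ v, τ v ≠ 0 → pos a v ≤ m) {x : Site L} (hx : τ x ≠ 0) (hxm : pos a x = m)
    {b : Bool × Site L} (hb : BondAnti b τ) (hclr : ∀ v, pos a v = m → bondMul b τ v = 0) :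
    b.2 = x - stepVec L b.1 ∧ τ x = bondLetter b.1 ∧
      LetterAnti (bondLetter b.1) (τ (x - stepVec L b.1)) ∧
      ∀ v, τ v ≠ 0 → pos a v = m → v = x := by
  have key : ∀ v, τ v ≠ 0 → pos a v = m → τ v = bondLetter b.1 ∧ v = b.2 + stepVec L b.1 := by
    intro v hv hvm
    obtain ⟨h1, h2 | h2⟩ := eq_or_eq_of_bondMul_eq_zero (hclr v hvm) hv
    · exfalso
      have h3 := pos_add_stepVec hL a b.2 b.1
      rw [← h2, hvm] at h3
      have h4 : τ (v + stepVec L b.1) = 0 := by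
        by_contra h4
        have := hlt _ h4
        lia
      unfold BondAnti at hb
      rw [← h2, h1, h4] at hb
      simp [not_letterAnti_self, not_letterAnti_zero] at hb
    · exact ⟨h1, h2⟩
  obtain ⟨h1, h2⟩ := key x hx hxm
  have h3 : x - stepVec L b.1 = b.2 := sub_eq_of_eq_add h2
  refine ⟨h3.symm, h1, ?_, fun v hv hvm => (key v hv hvm).2.trans h2.symm⟩
  unfold BondAnti at hb
  rw [← h2, h1] at hb
  rw [h3]
  simpa [not_letterAnti_self] using hb

/-- `x` is the only site of `σ` on the last of the `k` antidiagonals and is attached there by a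
bond of type `t`. -/
structure TopAt (σ : PSpec L) (a : ZMod L) (k : ℕ) (x : Site L) (t : Bool) : Prop where
  letter : σ x = bondLetter t
  pos_eq : pos a x = k - 1
  prev : σ (x - stepVec L t) ≠ 0
  unique : ∀ v, σ v ≠ 0 → pos a v = k - 1 → v = x

/-- `x` is the only site of `σ` on the first antidiagonal and is attached there by a bond of
type `t`. -/
structure BotAt (σ : PSpec L) (a : ZMod L) (x : Site L) (t : Bool) : Prop where
  letter : σ x = bondLetter t
  pos_eq : pos a x = 0
  next : σ (x + stepVec L t) ≠ 0
  unique : ∀ v, σ v ≠ 0 → pos a v = 0 → v = x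

/-- `q` is the coefficient function of an operator of diagonal length at most `k` commuting with
the Hamiltonian with couplings `J`. -/
structure LocalCharge (J : Bool → ℂ) (k : ℕ) (q : PSpec L → ℂ) : Prop where
  coupling_ne_zero : ∀ t, J t ≠ 0
  two_le : 2 ≤ k
  two_mul_le : 2 * k ≤ L
  diag_le : ∀ σ, q σ ≠ 0 → Diag L σ ≤ k
  sum_eq_zero : ∀ T : Op L,
    ∑ b : Bool × Site L, J b.1 * overlap q (opComm L (bondOp b) T) = 0

namespace LocalCharge

variable {J : Bool → ℂ} {k : ℕ} {q : PSpec L → ℂ}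

theorem one_lt (hq : LocalCharge J k q) : 1 < L := by
  have := hq.two_le
  have := hq.two_mul_le
  lia

theorem sum_subset (hq : LocalCharge J k q) {T : Op L} {τ : PSpec L} (hT : IsPauli T τ)
    (F : Finset (Bool × Site L))
    (hF : ∀ b ∉ F, BondAnti b τ → q (bondMul b τ) = 0) :
    ∑ b ∈ F, J b.1 * overlap q (opComm L (bondOp b) T) = 0 := by
  rw [← hq.sum_eq_zero T]
  refine Finset.sum_subset (Finset.subset_univ F) fun b _ hb => ?_
  by_cases ha : BondAnti b τ
  · rw [opComm_of_anticomm (ha.anticomm hq.one_lt hT), overlap_smul,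
      (hT.bondOp_mul b).overlap_eq_zero.mpr (hF b hb ha)]
    ring
  · rw [opComm, commute_of_not_bondAnti hq.one_lt ha hT, sub_self]
    simp [overlap]

/-- A contributing Pauli product cannot have sites on antidiagonals at distance `k`. -/
theorem clears_end (hq : LocalCharge J k q) {a : ZMod L} {ρ : PSpec L} (h : q ρ ≠ 0) :
    (∀ v, pos a v = 0 → ρ v = 0) ∨ (∀ v, pos a v = k → ρ v = 0) := by
  by_contra! hn
  obtain ⟨⟨v, hv0, hv⟩, w, hwk, hw⟩ := hn
  have h1 := lt_diag_of_ends hv hv0 hw hwk hq.two_mul_le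
  have h2 := hq.diag_le _ h
  lia

section extend_top

variable {a : ZMod L} {σ : PSpec L} {x : Site L} {t : Bool}

/-- The effect of attaching a new site beyond the last antidiagonal. -/
theorem extend_top_spec (hq : LocalCharge J k q) (hσ : Window a k σ) (hxk : pos a x = k - 1)
    (ht : LetterAnti (bondLetter t) (σ x)) :
    pos a (x + stepVec L t) = k ∧
    (∀ v, v ≠ x → v ≠ x + stepVec L t → bondMul (t, x) σ v = σ v) ∧
    bondMul (t, x) σ x = letterMul (bondLetter t) (σ x) ∧
    bondMul (t, x) σ (x + stepVec L t) = bondLetter t ∧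
    BondAnti (t, x) σ ∧
    (∀ v, bondMul (t, x) σ v ≠ 0 ↔ σ v ≠ 0 ∨ v = x + stepVec L t) := by
  have h1 := hq.two_le
  have h2 := hq.two_mul_le
  have hp : pos a (x + stepVec L t) = k := by
    have := pos_add_stepVec hq.one_lt a x t
    lia
  have h0 : σ (x + stepVec L t) = 0 := by
    by_contra h
    have := hσ.lt _ h
    lia
  have hleft : bondMul (t, x) σ x = letterMul (bondLetter t) (σ x) := bondMul_left (t, x) σ
  have hright : bondMul (t, x) σ (x + stepVec L t) = bondLetter t := by
    have := bondMul_right (t, x) σ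
    simpa [h0, letterMul_comm _ 0, zero_letterMul] using this
  have hne : ∀ v, v ≠ x → v ≠ x + stepVec L t → bondMul (t, x) σ v = σ v :=
    fun v hv hv' => bondMul_of_ne hv hv'
  refine ⟨hp, hne, hleft, hright, ?_, ?_⟩
  · simp [BondAnti, h0, ht, not_letterAnti_zero]
  · intro v
    by_cases hv : v = x
    · subst hv
      simp [hleft, ht.letterMul_ne_zero, ht.2.1]
    · by_cases hv' : v = x + stepVec L t
      · subst hv'
        simp [hright, bondLetter_ne_zero]
      · simp [hne v hv hv', hv']

/-- After attaching a site beyond the last antidiagonal, the only bonds that contribute remove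
that site again or remove the first antidiagonal. -/
theorem extend_top_contrib (hq : LocalCharge J k q) (hσ : Window a k σ) (hxk : pos a x = k - 1)
    (ht : LetterAnti (bondLetter t) (σ x)) {b : Bool × Site L}
    (hb : BondAnti b (bondMul (t, x) σ)) (hqb : q (bondMul b (bondMul (t, x) σ)) ≠ 0) :
    b = (t, x) ∨ BotAt σ a b.2 b.1 := by
  obtain ⟨hp, hne, hleft, hright, -, hsupp⟩ := hq.extend_top_spec hσ hxk ht
  have h1 := hq.two_le
  have h2 := hq.two_mul_le
  have hlt : ∀ v, bondMul (t, x) σ v ≠ 0 → pos a v ≤ k := by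
    intro v hv
    rcases (hsupp v).mp hv with hv | rfl
    · exact (hσ.lt v hv).le
    · exact hp.le
  rcases hq.clears_end (a := a) hqb with hclr | hclr
  · right
    obtain ⟨y, hy, hy0⟩ := hσ.bot
    obtain ⟨rfl, h4, h5, h6⟩ := bond_of_clears_bot hq.one_lt (by lia) hlt
      ((hsupp y).mpr (Or.inl hy)) hy0 hb hclr
    have hbx : b.2 ≠ x := by rintro h; rw [h] at hy0; lia
    have hbx' : b.2 ≠ x + stepVec L t := by rintro h; rw [h] at hy0; lia
    refine ⟨?_, hy0, ?_, fun v hv => h6 v ((hsupp v).mpr (Or.inl hv))⟩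
    · rwa [hne _ hbx hbx'] at h4
    · rcases (hsupp _).mp h5.2.1 with h | h
      · exact h
      · have h7 := pos_add_stepVec hq.one_lt a b.2 b.1
        rw [h] at h7
        lia
  · left
    obtain ⟨h3, h4, -, -⟩ := bond_of_clears_top hq.one_lt (by lia) hlt
      (by rw [hright]; exact bondLetter_ne_zero t) hp hb hclr
    rw [hright, bondLetter_inj] at h4
    rw [← h4, add_sub_cancel_right] at h3
    exact Prod.ext h4.symm h3

theorem exists_botAt (hq : LocalCharge J k q) (hσ : Window a k σ) (h : q σ ≠ 0) :
    ∃ y s, BotAt σ a y s := by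
  by_contra! hn
  obtain ⟨x, hx, hxk⟩ := hσ.top
  obtain ⟨t, ht⟩ := exists_letterAnti_bondLetter hx
  have hM := isPauli_PauliOp σ
  have h1 := hq.sum_subset (hM.bondOp_mul (t, x)) {(t, x)} (by
    intro b hb hba
    by_contra hqb
    rcases hq.extend_top_contrib hσ hxk ht hba hqb with h2 | h2
    · exact hb (Finset.mem_singleton.mpr h2)
    · exact hn _ _ h2)
  rw [Finset.sum_singleton, opComm_bond_mul hq.one_lt (hq.extend_top_spec hσ hxk ht).2.2.2.2.1 hM,
    overlap_smul] at h1
  have h2 : overlap q (PauliOp L σ) ≠ 0 := fun h3 => h (hM.overlap_eq_zero.mp h3)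
  exact mul_ne_zero (hq.coupling_ne_zero t) (mul_ne_zero two_ne_zero h2) h1

end extend_top

theorem exists_topAt (hq : LocalCharge J k q) {a : ZMod L} {σ : PSpec L} (hσ : Window a k σ)
    (h : q σ ≠ 0) : ∃ x t, TopAt σ a k x t := by
  by_contra! hn
  have hk := hq.two_le
  have hkL := hq.two_mul_le
  obtain ⟨x, hx, hx0⟩ := hσ.bot
  obtain ⟨t, ht⟩ := exists_letterAnti_bondLetter hx
  set y := x - stepVec L t with hy
  have hyx : y + stepVec L t = x := sub_add_cancel _ _
  have hy0 : pos (a - 1) y = 0 := by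
    have h1 := pos_sub_stepVec hq.one_lt a x t
    have h2 := pos_sub_one hq.one_lt a y
    lia
  have hshift : ∀ v, σ v ≠ 0 → pos (a - 1) v = pos a v + 1 := by
    intro v hv
    have h1 := hσ.lt v hv
    have h2 := pos_sub_one hq.one_lt a v
    lia
  have h0 : σ y = 0 := by
    by_contra h1
    have := hshift y h1
    lia
  have hleft : bondMul (t, y) σ y = bondLetter t := by
    have := bondMul_left (t, y) σ
    simpa [h0, letterMul_comm _ 0, zero_letterMul] using this
  have hright : bondMul (t, y) σ x = letterMul (bondLetter t) (σ x) := by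
    have := bondMul_right (t, y) σ
    simpa [hyx] using this
  have hne : ∀ v, v ≠ y → v ≠ x → bondMul (t, y) σ v = σ v :=
    fun v hv hv' => bondMul_of_ne hv (by simpa [hyx] using hv')
  have hsupp : ∀ v, bondMul (t, y) σ v ≠ 0 ↔ σ v ≠ 0 ∨ v = y := by
    intro v
    by_cases hv : v = y
    · simp [hv, hleft, bondLetter_ne_zero]
    · by_cases hv' : v = x
      · subst hv'
        simp [hright, ht.letterMul_ne_zero, ht.2.1]
      · simp [hne v hv hv', hv]
  have hanti : BondAnti (t, y) σ := by
    simp [BondAnti, h0, hyx, ht, not_letterAnti_zero]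
  have hlt : ∀ v, bondMul (t, y) σ v ≠ 0 → pos (a - 1) v ≤ k := by
    intro v hv
    rcases (hsupp v).mp hv with hv | rfl
    · have h1 := hσ.lt v hv
      have h2 := hshift v hv
      lia
    · lia
  have hM := isPauli_PauliOp σ
  have h1 := hq.sum_subset (hM.bondOp_mul (t, y)) {(t, y)} (by
    intro b hb hba
    by_contra hqb
    rcases hq.clears_end (a := a - 1) hqb with hclr | hclr
    · obtain ⟨h3, h4, -, -⟩ := bond_of_clears_bot hq.one_lt (by lia) hlt
        (by rw [hleft]; exact bondLetter_ne_zero t) hy0 hba hclr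
      rw [hleft, bondLetter_inj] at h4
      exact hb (Finset.mem_singleton.mpr (Prod.ext h4.symm h3))
    · obtain ⟨z, hz, hzk⟩ := hσ.top
      have hzk' := hshift z hz
      obtain ⟨h3, h4, h5, h6⟩ := bond_of_clears_top hq.one_lt (by lia) hlt
        ((hsupp z).mpr (Or.inl hz)) (by lia) hba hclr
      have hzy : z ≠ y := by rintro rfl; exact hz h0
      have hzx : z ≠ x := by rintro rfl; lia
      refine hn z b.1 ⟨?_, hzk, ?_, ?_⟩
      · rwa [hne z hzy hzx] at h4
      · rcases (hsupp _).mp h5.2.1 with h | h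
        · exact h
        · have h7 := pos_sub_stepVec hq.one_lt (a - 1) z b.1
          rw [h] at h7
          lia
      · intro v hv hvk
        have h8 := hshift v hv
        exact h6 v ((hsupp v).mpr (Or.inl hv)) (by lia))
  rw [Finset.sum_singleton, opComm_bond_mul hq.one_lt hanti hM, overlap_smul] at h1
  have h2 : overlap q (PauliOp L σ) ≠ 0 := fun h3 => h (hM.overlap_eq_zero.mp h3)
  exact mul_ne_zero (hq.coupling_ne_zero t) (mul_ne_zero two_ne_zero h2) h1

end LocalCharge

end

section

variable {L : ℕ} [NeZero L]

/-- The Pauli product obtained from `σ` by attaching a bond of type `!t` at `x` and then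
multiplying by the bond of type `s` at `y`. -/
def shiftSpec (x : Site L) (t : Bool) (y : Site L) (s : Bool) (σ : PSpec L) : PSpec L :=
  bondMul (s, y) (bondMul (!t, x) σ)

namespace LocalCharge

variable {J : Bool → ℂ} {k : ℕ} {q : PSpec L → ℂ} {a : ZMod L} {σ : PSpec L} {x y : Site L}
  {t s : Bool}

theorem extend_top_of_topAt (hq : LocalCharge J k q) (hσ : Window a k σ) (hx : TopAt σ a k x t) :
    pos a (x + stepVec L (!t)) = k ∧
    (∀ v, v ≠ x → v ≠ x + stepVec L (!t) → bondMul (!t, x) σ v = σ v) ∧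
    bondMul (!t, x) σ x = 3 ∧
    bondMul (!t, x) σ (x + stepVec L (!t)) = bondLetter (!t) ∧
    BondAnti (!t, x) σ ∧
    (∀ v, bondMul (!t, x) σ v ≠ 0 ↔ σ v ≠ 0 ∨ v = x + stepVec L (!t)) := by
  have h := hq.extend_top_spec (t := !t) hσ hx.pos_eq
    (by rw [hx.letter]; simpa using letterAnti_bondLetter_not (!t))
  rwa [hx.letter, letterMul_bondLetter_not'] at h

theorem shift_sum (hq : LocalCharge J k q) (hσ : Window a k σ) (hx : TopAt σ a k x t)
    (hy : BotAt σ a y s) {M : Op L} (hM : IsPauli M σ) :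
    J (!t) * (2 * overlap q M) +
      J s * overlap q (opComm L (bondOp (s, y)) (bondOp (!t, x) * M)) = 0 := by
  have hk := hq.two_le
  have hne : ((!t, x) : Bool × Site L) ≠ (s, y) := by
    intro h
    obtain rfl : x = y := (Prod.ext_iff.mp h).2
    have h1 := hx.pos_eq
    have h2 := hy.pos_eq
    lia
  have h1 := hq.sum_subset (hM.bondOp_mul (!t, x)) {(!t, x), (s, y)} (by
    intro b hb hba
    by_contra hqb
    rcases hq.extend_top_contrib hσ hx.pos_eq
      (by rw [hx.letter]; simpa using letterAnti_bondLetter_not (!t)) hba hqb with h2 | h2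
    · exact hb (by simp [h2])
    · have h3 : b.2 = y := hy.unique _ (by rw [h2.letter]; exact bondLetter_ne_zero _) h2.pos_eq
      have h4 := h2.letter
      rw [h3, hy.letter, bondLetter_inj] at h4
      exact hb (by simp [Prod.ext_iff, h3, h4]))
  rwa [Finset.sum_pair hne, opComm_bond_mul hq.one_lt (hq.extend_top_of_topAt hσ hx).2.2.2.2.1 hM,
    overlap_smul] at h1

theorem shift_anti (hq : LocalCharge J k q) (hσ : Window a k σ) (hx : TopAt σ a k x t)
    (hy : BotAt σ a y s) (h : q σ ≠ 0) : BondAnti (s, y) (bondMul (!t, x) σ) := by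
  by_contra hn
  have hM := isPauli_PauliOp σ
  have h1 := hq.shift_sum hσ hx hy hM
  rw [opComm, commute_of_not_bondAnti hq.one_lt hn (hM.bondOp_mul _), sub_self] at h1
  have h2 : overlap q (PauliOp L σ) ≠ 0 := fun h3 => h (hM.overlap_eq_zero.mp h3)
  refine mul_ne_zero (hq.coupling_ne_zero (!t)) (mul_ne_zero two_ne_zero h2) ?_
  simpa [overlap] using h1

theorem shift_overlap (hq : LocalCharge J k q) (hσ : Window a k σ) (hx : TopAt σ a k x t)
    (hy : BotAt σ a y s) (hanti : BondAnti (s, y) (bondMul (!t, x) σ)) {M : Op L}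
    (hM : IsPauli M σ) :
    J (!t) * overlap q M + J s * overlap q (bondOp (s, y) * (bondOp (!t, x) * M)) = 0 := by
  have h1 := hq.shift_sum hσ hx hy hM
  rw [opComm_of_anticomm (hanti.anticomm hq.one_lt (hM.bondOp_mul _)), overlap_smul] at h1
  linear_combination h1 / 2

theorem shift_ne_zero (hq : LocalCharge J k q) (hσ : Window a k σ) (hx : TopAt σ a k x t)
    (hy : BotAt σ a y s) (h : q σ ≠ 0) : q (shiftSpec x t y s σ) ≠ 0 := by
  intro h0
  have hM := isPauli_PauliOp σ
  have h1 := hq.shift_overlap hσ hx hy (hq.shift_anti hσ hx hy h) hM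
  rw [((hM.bondOp_mul (!t, x)).bondOp_mul (s, y)).overlap_eq_zero.mpr h0, mul_zero, add_zero] at h1
  exact mul_ne_zero (hq.coupling_ne_zero (!t)) (fun h3 => h (hM.overlap_eq_zero.mp h3)) h1

theorem shift_support (hq : LocalCharge J k q) (hσ : Window a k σ) (hx : TopAt σ a k x t)
    (hy : BotAt σ a y s) (hanti : BondAnti (s, y) (bondMul (!t, x) σ)) (v : Site L) :
    shiftSpec x t y s σ v ≠ 0 ↔ σ v ≠ 0 ∧ v ≠ y ∨ v = x + stepVec L (!t) := by
  obtain ⟨hp, hne, -, -, -, hsupp⟩ := hq.extend_top_of_topAt hσ hx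
  have hk := hq.two_le
  have hyx : y ≠ x := by
    rintro rfl
    have h1 := hx.pos_eq
    have h2 := hy.pos_eq
    lia
  have hyx' : y ≠ x + stepVec L (!t) := by
    intro h
    have h2 := hy.pos_eq
    rw [h] at h2
    lia
  have hρy : bondMul (!t, x) σ y = bondLetter s := by rw [hne y hyx hyx', hy.letter]
  by_cases hvy : v = y
  · subst hvy
    have h1 : shiftSpec x t v s σ v = 0 := by
      have := bondMul_left (s, v) (bondMul (!t, x) σ)
      rw [shiftSpec, this, letterMul_eq_zero, hρy]
    simp [h1, hyx']
  · by_cases hvy' : v = y + stepVec L s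
    · subst hvy'
      have h2 : LetterAnti (bondLetter s) (bondMul (!t, x) σ (y + stepVec L s)) := by
        unfold BondAnti at hanti
        simpa [hρy, not_letterAnti_self] using hanti
      have h3 := bondMul_right (s, y) (bondMul (!t, x) σ)
      simp only at h3
      have h4 := (hsupp _).mp h2.2.1
      rw [shiftSpec, h3]
      simp [h2.letterMul_ne_zero, h4, hvy]
    · have h3 : shiftSpec x t y s σ v = bondMul (!t, x) σ v := bondMul_of_ne hvy hvy'
      rw [h3, hsupp]
      simp [hvy]

theorem shift_window (hq : LocalCharge J k q) (hσ : Window a k σ) (hx : TopAt σ a k x t)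
    (hy : BotAt σ a y s) (hanti : BondAnti (s, y) (bondMul (!t, x) σ)) :
    Window (a + 1) k (shiftSpec x t y s σ) := by
  have hsupp := hq.shift_support hσ hx hy hanti
  have hk := hq.two_le
  have hkL := hq.two_mul_le
  have hp := (hq.extend_top_of_topAt hσ hx).1
  have hy0 := hy.pos_eq
  refine ⟨fun v hv => ?_, ⟨y + stepVec L s, ?_, ?_⟩, ⟨x + stepVec L (!t), ?_, ?_⟩⟩
  · have h1 := pos_add_one hq.one_lt a v
    rcases (hsupp v).mp hv with ⟨h2, h3⟩ | rfl
    · have h4 := hσ.lt v h2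
      have h5 : pos a v ≠ 0 := fun h => h3 (hy.unique v h2 h)
      lia
    · lia
  · exact (hsupp _).mpr (Or.inl ⟨hy.next, fun h => stepVec_ne_zero hq.one_lt s (by simpa using h)⟩)
  · have h1 := pos_add_stepVec hq.one_lt a y s
    have h2 := pos_add_one hq.one_lt a (y + stepVec L s)
    lia
  · exact (hsupp _).mpr (Or.inr rfl)
  · have h2 := pos_add_one hq.one_lt a (x + stepVec L (!t))
    lia

/-- A contributing Pauli product has at most one site on each antidiagonal. -/
theorem eq_of_pos_eq (hq : LocalCharge J k q) (hσ : Window a k σ) (h : q σ ≠ 0) {v w : Site L}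
    (hv : σ v ≠ 0) (hw : σ w ≠ 0) (hvw : pos a v = pos a w) : v = w := by
  obtain ⟨i, hi⟩ : ∃ i, pos a v = i := ⟨_, rfl⟩
  induction i generalizing a σ with
  | zero =>
    obtain ⟨y, s, hy⟩ := hq.exists_botAt hσ h
    rw [hy.unique v hv hi, hy.unique w hw (by lia)]
  | succ i ih =>
    obtain ⟨y, s, hy⟩ := hq.exists_botAt hσ h
    obtain ⟨x, t, hx⟩ := hq.exists_topAt hσ h
    have hanti := hq.shift_anti hσ hx hy h
    have hsupp := hq.shift_support hσ hx hy hanti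
    have hy0 := hy.pos_eq
    have h1 := pos_add_one hq.one_lt a v
    have h2 := pos_add_one hq.one_lt a w
    refine ih (hq.shift_window hσ hx hy hanti) (hq.shift_ne_zero hσ hx hy h)
      ((hsupp v).mpr (Or.inl ⟨hv, ?_⟩)) ((hsupp w).mpr (Or.inl ⟨hw, ?_⟩)) (by lia) (by lia)
    · rintro rfl
      lia
    · rintro rfl
      lia

end LocalCharge

end

section

variable {L : ℕ}

theorem letterAnti_bondSpec {b c : Bool × Site L} (h : b.1 = c.1) (v : Site L) :
    ¬ LetterAnti (bondLetter b.1) (bondSpec c v) := by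
  unfold bondSpec
  rw [h]
  split_ifs <;> simp [not_letterAnti_self, not_letterAnti_zero]

variable [NeZero L]

theorem bondOp_comm_of_type_eq (hL : 1 < L) {b c : Bool × Site L} (h : b.1 = c.1) :
    bondOp b * bondOp c = bondOp c * bondOp b :=
  commute_of_not_bondAnti hL (by simp [BondAnti, letterAnti_bondSpec h]) (isPauli_PauliOp _)

theorem bondOp_comm_of_disjoint (hL : 1 < L) {b c : Bool × Site L} (h1 : b.2 ≠ c.2)
    (h2 : b.2 ≠ c.2 + stepVec L c.1) (h3 : b.2 + stepVec L b.1 ≠ c.2)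
    (h4 : b.2 + stepVec L b.1 ≠ c.2 + stepVec L c.1) :
    bondOp b * bondOp c = bondOp c * bondOp b :=
  commute_of_not_bondAnti hL (by simp [BondAnti, bondSpec, h1, h2, h3, h4]) (isPauli_PauliOp _)

/-- `σ` turns at the site `w` of the antidiagonal `p`: it is continued upwards from `w` by a bond
of type `!t`, and the neighbouring bonds, if any, have type `t`. -/
structure TurnAt (σ : PSpec L) (a : ZMod L) (k p : ℕ) (w : Site L) (t : Bool) : Prop where
  lt : p + 1 < k
  pos_eq : pos a w = p
  ne_zero : σ w ≠ 0
  top_letter : p + 2 = k → σ (w + stepVec L (!t)) = bondLetter (!t)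
  next_letter : p + 2 < k → σ (w + stepVec L (!t)) = 3
  next : p + 2 < k → σ (w + stepVec L (!t) + stepVec L t) ≠ 0
  letter : 1 ≤ p → σ w = 3
  prev : 1 ≤ p → σ (w - stepVec L t) ≠ 0

namespace LocalCharge

variable {J : Bool → ℂ} {k p : ℕ} {q : PSpec L → ℂ} {a : ZMod L} {σ : PSpec L} {x y w : Site L}
  {t t' s : Bool}

theorem shiftSpec_of_two_le_pos (hq : LocalCharge J k q) (hy : BotAt σ a y s) {v : Site L}
    (hv : 2 ≤ pos a v) :
    shiftSpec x t' y s σ v = bondMul (!t', x) σ v := by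
  have hy0 := hy.pos_eq
  have h1 := pos_add_stepVec hq.one_lt a y s
  refine bondMul_of_ne (fun h => ?_) (fun h => ?_) <;> rw [h] at hv <;> simp only at hv <;> lia

theorem turnAt_of_topAt (hq : LocalCharge J k q) (hk : 3 ≤ k) (hσ : Window a k σ)
    (hx : TopAt σ a k x t) (hy : BotAt σ a y s) (h : q σ ≠ 0) :
    TurnAt (shiftSpec x t y s σ) (a + 1) k (k - 2) x t := by
  obtain ⟨hp, hne, hx3, hx', -, -⟩ := hq.extend_top_of_topAt hσ hx
  have hsupp := hq.shift_support hσ hx hy (hq.shift_anti hσ hx hy h)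
  have hxp := hx.pos_eq
  have hy0 := hy.pos_eq
  have h1 := pos_add_one hq.one_lt a x
  have hx3' : shiftSpec x t y s σ x = 3 := by
    rw [hq.shiftSpec_of_two_le_pos hy (by lia), hx3]
  refine ⟨by lia, by lia, by rw [hx3']; decide, fun _ => ?_, by lia, by lia, fun _ => hx3',
    fun _ => (hsupp _).mpr (Or.inl ⟨hx.prev, ?_⟩)⟩
  · rw [hq.shiftSpec_of_two_le_pos hy (by lia), hx']
  · rintro rfl
    have h2 := pos_sub_stepVec hq.one_lt a x t
    lia

theorem turnAt_shift (hq : LocalCharge J k q) (hσ : Window a k σ)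
    (hx : TopAt σ a k x t') (hy : BotAt σ a y s) (h : q σ ≠ 0)
    (hw : TurnAt σ a k (p + 1) w t) : TurnAt (shiftSpec x t' y s σ) (a + 1) k p w t := by
  obtain ⟨hp, hne, hx3, hx', -, -⟩ := hq.extend_top_of_topAt hσ hx
  have hsupp := hq.shift_support hσ hx hy (hq.shift_anti hσ hx hy h)
  have hkL := hq.two_mul_le
  have hxp := hx.pos_eq
  have hy0 := hy.pos_eq
  have hwp := hw.pos_eq
  have hlt := hw.lt
  have hw1 := pos_add_one hq.one_lt a w
  have hu := pos_add_stepVec hq.one_lt a w (!t)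
  have hut := pos_add_stepVec hq.one_lt a (w + stepVec L (!t)) t
  have hold : ∀ v, 2 ≤ pos a v → pos a v + 1 < k → shiftSpec x t' y s σ v = σ v := by
    intro v hv hvk
    rw [hq.shiftSpec_of_two_le_pos hy hv, hne]
    · rintro rfl
      lia
    · rintro rfl
      lia
  refine ⟨by lia, by lia, (hsupp w).mpr (Or.inl ⟨hw.ne_zero, ?_⟩), by lia, fun _ => ?_,
    fun _ => ?_, fun h1 => ?_, fun h1 => (hsupp _).mpr (Or.inl ⟨hw.prev (by lia), ?_⟩)⟩
  · rintro rfl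
    lia
  · rcases Nat.lt_or_ge (p + 3) k with h1 | h1
    · rw [hold _ (by lia) (by lia), hw.next_letter (by lia)]
    · have h2 := hw.top_letter (by lia)
      have h3 : w + stepVec L (!t) = x :=
        hx.unique _ (by rw [h2]; exact bondLetter_ne_zero _) (by lia)
      rw [h3, hq.shiftSpec_of_two_le_pos hy (by lia), hx3]
  · rcases Nat.lt_or_ge (p + 3) k with h1 | h1
    · refine (hsupp _).mpr (Or.inl ⟨hw.next h1, ?_⟩)
      rintro h2
      rw [h2] at hut
      lia
    · have h2 := hw.top_letter (by lia)
      have h3 : w + stepVec L (!t) = x :=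
        hx.unique _ (by rw [h2]; exact bondLetter_ne_zero _) (by lia)
      have h4 := hx.letter
      rw [← h3, h2, bondLetter_inj] at h4
      refine (hsupp _).mpr (Or.inr ?_)
      rw [h3, ← h4, Bool.not_not]
  · rw [hold _ (by lia) (by lia), hw.letter (by lia)]
  · rintro h2
    have h3 := pos_sub_stepVec hq.one_lt a w t
    rw [h2] at h3
    lia

/-- The only bonds contributing to the equation obtained by attaching a side bond at a turn. -/
theorem side_contrib (hq : LocalCharge J k q) (hk : 3 ≤ k) (hσ : Window a k σ)
    (hx : TopAt σ a k x t') (hy : BotAt σ a y s) (h : q σ ≠ 0) (hw : TurnAt σ a k p w t) :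
    BondAnti (t, w) σ ∧ ∀ b, BondAnti b (bondMul (t, w) σ) →
      q (bondMul b (bondMul (t, w) σ)) ≠ 0 →
      b = (t, w) ∨ (1 ≤ p ∧ b = (s, y)) ∨ (p + 2 < k ∧ b = (t', x - stepVec L t')) := by
  have hL := hq.one_lt
  have hkL := hq.two_mul_le
  have hxp := hx.pos_eq
  have hy0 := hy.pos_eq
  have hwp := hw.pos_eq
  have hlt := hw.lt
  have hpu := pos_add_stepVec hL a w (!t)
  have hpr := pos_add_stepVec hL a w t
  obtain ⟨u, hu⟩ : ∃ u, w + stepVec L (!t) = u := ⟨_, rfl⟩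
  obtain ⟨r, hr⟩ : ∃ r, w + stepVec L t = r := ⟨_, rfl⟩
  rw [hu] at hpu
  rw [hr] at hpr
  have hur : u ≠ r := by
    rintro rfl
    have := stepVec_injective hL (add_left_cancel (hu.trans hr.symm))
    simp at this
  have hwr : r ≠ w := by rintro rfl; lia
  have hwu : u ≠ w := by rintro rfl; lia
  have hσu : σ u ≠ 0 := by
    rcases Nat.lt_or_ge (p + 2) k with h1 | h1
    · rw [← hu, hw.next_letter h1]; decide
    · rw [← hu, hw.top_letter (by lia)]; exact bondLetter_ne_zero _
  have hσr : σ r = 0 := by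
    by_contra h1
    exact hur (hq.eq_of_pos_eq hσ h hσu h1 (by lia))
  have hσw : (1 ≤ p ∧ σ w = 3) ∨ (p = 0 ∧ σ w = bondLetter (!t)) := by
    rcases Nat.eq_zero_or_pos p with h1 | h1
    · right
      have h2 : w = y := hy.unique w hw.ne_zero (by lia)
      refine ⟨h1, ?_⟩
      have h3 := hy.next
      rw [h2, hy.letter, bondLetter_inj]
      by_contra h4
      have h5 : s = t := by revert h4; cases s <;> cases t <;> simp
      rw [h5, ← h2, hr] at h3
      exact h3 hσr
    · exact Or.inl ⟨h1, hw.letter h1⟩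
  have hτw : bondMul (t, w) σ w = letterMul (bondLetter t) (σ w) := bondMul_left (t, w) σ
  have hτr : bondMul (t, w) σ r = bondLetter t := by
    have h1 := bondMul_right (t, w) σ
    simp only [hr, hσr] at h1
    rw [h1, letterMul_comm, zero_letterMul]
  have hτ : ∀ v, v ≠ w → v ≠ r → bondMul (t, w) σ v = σ v :=
    fun v h1 h2 => bondMul_of_ne h1 (by rw [hr]; exact h2)
  have hwanti : LetterAnti (bondLetter t) (σ w) := by
    rcases hσw with ⟨-, h1⟩ | ⟨-, h1⟩ <;> rw [h1]
    · exact letterAnti_bondLetter_three t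
    · exact letterAnti_bondLetter_not t
  have hsupp : ∀ v, bondMul (t, w) σ v ≠ 0 ↔ σ v ≠ 0 ∨ v = r := by
    intro v
    by_cases h1 : v = r
    · simp [h1, hτr, bondLetter_ne_zero]
    · by_cases h2 : v = w
      · subst h2
        simp [hτw, hwanti.letterMul_ne_zero, hw.ne_zero]
      · simp [hτ v h2 h1, h1]
  have hle : ∀ v, bondMul (t, w) σ v ≠ 0 → pos a v ≤ k - 1 := by
    intro v hv
    rcases (hsupp v).mp hv with h1 | rfl
    · have := hσ.lt v h1
      lia
    · lia
  have hσy : σ y ≠ 0 := by rw [hy.letter]; exact bondLetter_ne_zero _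
  have hσx : σ x ≠ 0 := by rw [hx.letter]; exact bondLetter_ne_zero _
  refine ⟨by simp [BondAnti, hr, hσr, hwanti, not_letterAnti_zero], fun b hb hqb => ?_⟩
  by_cases hclr : ∀ v, pos a v = 0 → bondMul b (bondMul (t, w) σ) v = 0
  · obtain ⟨h1, h2, -, -⟩ := bond_of_clears_bot hL (by lia) hle
      ((hsupp y).mpr (Or.inl hσy)) hy0 hb hclr
    rcases hσw with ⟨h3, -⟩ | ⟨h3, h4⟩
    · rw [hτ y (by rintro rfl; lia) (by rintro rfl; lia), hy.letter, bondLetter_inj] at h2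
      exact Or.inr (Or.inl ⟨h3, Prod.ext h2.symm h1⟩)
    · have h5 : w = y := hy.unique w hw.ne_zero (by lia)
      rw [← h5, hτw, h4, letterMul_bondLetter_not] at h2
      exact absurd h2.symm (bondLetter_ne_three _)
  by_cases hclr' : ∀ v, pos a v = k - 1 → bondMul b (bondMul (t, w) σ) v = 0
  · obtain ⟨h1, h2, -, h4⟩ := bond_of_clears_top hL (by lia) hle
      ((hsupp x).mpr (Or.inl hσx)) hxp hb hclr'
    rcases Nat.lt_or_ge (p + 2) k with h3 | h3
    · rw [hτ x (by rintro rfl; lia) (by rintro rfl; lia), hx.letter, bondLetter_inj] at h2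
      subst h2
      exact Or.inr (Or.inr ⟨h3, Prod.ext rfl h1⟩)
    · exact absurd ((h4 u ((hsupp u).mpr (Or.inl hσu)) (by lia)).trans
        (h4 r ((hsupp r).mpr (Or.inr rfl)) (by lia)).symm) hur
  push Not at hclr hclr'
  obtain ⟨v₀, hv₀, hv₀'⟩ := hclr
  obtain ⟨v₁, hv₁, hv₁'⟩ := hclr'
  have hρ := window_of_ends hL hq.two_le hkL (hq.diag_le _ hqb) hv₀' hv₀ hv₁' hv₁
  by_cases hr0 : bondMul b (bondMul (t, w) σ) r = 0
  · obtain ⟨h1, h2⟩ := eq_or_eq_of_bondMul_eq_zero hr0 ((hsupp r).mpr (Or.inr rfl))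
    rw [hτr, bondLetter_inj] at h1
    rcases h2 with h2 | h2
    · exfalso
      have h3 : bondMul (t, w) σ (r + stepVec L t) ≠ 0 := by
        intro h3
        unfold BondAnti at hb
        rw [← h2, ← h1, h3, hτr] at hb
        simp [not_letterAnti_self, not_letterAnti_zero] at hb
      have h4 := hle _ h3
      have h5 := pos_add_stepVec hL a r t
      have h6 := pos_add_stepVec hL a u t
      have h7 : σ (r + stepVec L t) ≠ 0 := by
        refine ((hsupp _).mp h3).resolve_right fun h7 => ?_
        rw [h7] at h5
        lia
      have h8 := hw.next (by lia)
      rw [hu] at h8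
      exact hur (add_right_cancel (hq.eq_of_pos_eq hσ h h8 h7 (by lia)))
    · rw [← h1, ← hr] at h2
      exact Or.inl (Prod.ext h1.symm (add_right_cancel h2).symm)
  · exfalso
    have hu0 : bondMul b (bondMul (t, w) σ) u = 0 := by
      by_contra hu0
      exact hur (hq.eq_of_pos_eq hρ hqb hu0 hr0 (by lia))
    obtain ⟨h1, h2⟩ := eq_or_eq_of_bondMul_eq_zero hu0 ((hsupp u).mpr (Or.inl hσu))
    rw [hτ u hwu hur, ← hu] at h1
    rcases Nat.lt_or_ge (p + 2) k with h3 | h3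
    · rw [hw.next_letter h3] at h1
      exact bondLetter_ne_three _ h1.symm
    · rw [hw.top_letter (by lia), bondLetter_inj] at h1
      unfold BondAnti at hb
      rcases h2 with h2 | h2
      · have h4 : bondMul (t, w) σ (u + stepVec L (!t)) = 0 := by
          by_contra h4
          have h5 := hle _ h4
          have h6 := pos_add_stepVec hL a u (!t)
          lia
        rw [← h2, ← h1, h4, hτ u hwu hur, ← hu, hw.top_letter (by lia)] at hb
        simp [not_letterAnti_self, not_letterAnti_zero] at hb
      · have h4 : b.2 = w := by
          rw [← h1, ← hu] at h2
          exact (add_right_cancel h2).symm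
        rw [h4, ← h1, hu, hτw, hw.letter (by lia), letterMul_bondLetter_three, hτ u hwu hur, ← hu,
          hw.top_letter (by lia)] at hb
        simp at hb

end LocalCharge

end

section

variable {L : ℕ} [NeZero L]

namespace LocalCharge

variable {J : Bool → ℂ} {k p : ℕ} {q : PSpec L → ℂ} {a : ZMod L} {σ : PSpec L} {x y w : Site L}
  {t t' s : Bool}

theorem side_sum (hq : LocalCharge J k q) (hk : 3 ≤ k) (hσ : Window a k σ)
    (hx : TopAt σ a k x t') (hy : BotAt σ a y s) (h : q σ ≠ 0) (hw : TurnAt σ a k p w t)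
    {M : Op L} (hM : IsPauli M σ) :
    J t * (2 * overlap q M) +
      ((if 1 ≤ p then J s * overlap q (opComm L (bondOp (s, y)) (bondOp (t, w) * M)) else 0) +
      (if p + 2 < k then
        J t' * overlap q (opComm L (bondOp (t', x - stepVec L t')) (bondOp (t, w) * M))
        else 0)) = 0 := by
  obtain ⟨hanti, hF⟩ := hq.side_contrib hk hσ hx hy h hw
  have hlt := hw.lt
  have hwp := hw.pos_eq
  have hy0 := hy.pos_eq
  have hxp := hx.pos_eq
  have hxt := pos_sub_stepVec hq.one_lt a x t'
  have hVb : 1 ≤ p → ((t, w) : Bool × Site L) ≠ (s, y) := by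
    rintro h1 ⟨⟩
    lia
  have hVc : p + 2 < k → ((t, w) : Bool × Site L) ≠ (t', x - stepVec L t') := by
    intro h1 h2
    have h3 : w = x - stepVec L t' := (Prod.ext_iff.mp h2).2
    rw [← h3] at hxt
    lia
  have hbc : ((s, y) : Bool × Site L) ≠ (t', x - stepVec L t') := by
    intro h2
    have h3 : y = x - stepVec L t' := (Prod.ext_iff.mp h2).2
    rw [← h3] at hxt
    lia
  have key (F : Finset (Bool × Site L)) (hF' : ∀ b ∉ F, ¬ (b = (t, w) ∨ (1 ≤ p ∧ b = (s, y)) ∨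
      (p + 2 < k ∧ b = (t', x - stepVec L t')))) :=
    hq.sum_subset (hM.bondOp_mul (t, w)) F
      (fun b hb hba => by_contra fun hqb => hF' b hb (hF b hba hqb))
  have hV := opComm_bond_mul hq.one_lt hanti hM
  split_ifs with h1 h2 h2
  · have := key {(t, w), (s, y), (t', x - stepVec L t')} (fun b hb hb' => hb (by simp; tauto))
    rwa [Finset.sum_insert
      (by simp only [Finset.mem_insert, Finset.mem_singleton]; exact not_or.mpr ⟨hVb h1, hVc h2⟩),
      Finset.sum_pair hbc, hV, overlap_smul] at this
  · have := key {(t, w), (s, y)} (fun b hb hb' => hb (by simp; tauto))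
    rwa [Finset.sum_pair (hVb h1), hV, overlap_smul, ← add_zero (_ * overlap q (opComm _ _ _))]
      at this
  · have := key {(t, w), (t', x - stepVec L t')} (fun b hb hb' => hb (by simp; tauto))
    rwa [Finset.sum_pair (hVc h2), hV, overlap_smul, ← zero_add (_ * overlap q (opComm _ _ _))]
      at this
  · lia

/-- Pushing a turn down to the bottom, one antidiagonal per shift, leads to a contradiction. -/
theorem not_turnAt (hq : LocalCharge J k q) (hk : 3 ≤ k) (n : ℕ) (hσ : Window a k σ)
    (h : q σ ≠ 0) (hw : TurnAt σ a k p w t) {M : Op L} (hM : IsPauli M σ)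
    (htop : ∀ x t', TopAt σ a k x t' → (if p + 2 < k then
        J t' * overlap q (opComm L (bondOp (t', x - stepVec L t')) (bondOp (t, w) * M))
        else 0) = 2 * n * (J t * overlap q M)) : False := by
  have hL := hq.one_lt
  have hkL := hq.two_mul_le
  induction p generalizing a σ M n with
  | zero =>
    obtain ⟨y, s, hy⟩ := hq.exists_botAt hσ h
    obtain ⟨x, t', hx⟩ := hq.exists_topAt hσ h
    have h1 := hq.side_sum hk hσ hx hy h hw hM
    rw [htop x t' hx, if_neg (by lia)] at h1
    have h2 : (n + 1 : ℂ) * (J t * overlap q M) = 0 := by linear_combination h1 / 2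
    exact mul_ne_zero n.cast_add_one_ne_zero
      (mul_ne_zero (hq.coupling_ne_zero t) fun h3 => h (hM.overlap_eq_zero.mp h3)) h2
  | succ p ih =>
    obtain ⟨y, s, hy⟩ := hq.exists_botAt hσ h
    obtain ⟨x, r, hx⟩ := hq.exists_topAt hσ h
    have h1 := hq.side_sum hk hσ hx hy h hw hM
    rw [htop x r hx, if_pos (by lia)] at h1
    obtain ⟨hp, hne, -, hnew, hBanti, -⟩ := hq.extend_top_of_topAt hσ hx
    have hshift := hq.shift_anti hσ hx hy h
    have hlt := hw.lt
    have hwp := hw.pos_eq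
    have hy0 := hy.pos_eq
    have hxp := hx.pos_eq
    have hye := pos_add_stepVec hL a y s
    have hwe := pos_add_stepVec hL a w t
    have hwe' := pos_add_stepVec hL a w (!t)
    have hwd := pos_sub_stepVec hL a w t
    have hyanti : BondAnti (s, y) σ := by
      unfold BondAnti at hshift ⊢
      simp only at hshift ⊢
      rwa [hne y (by rintro rfl; lia) (by rintro rfl; lia),
        hne (y + stepVec L s) (by rintro rfl; lia) (by intro h2; rw [h2] at hye; lia)] at hshift
    have hbV : bondOp (s, y) * bondOp (t, w) = bondOp (t, w) * bondOp (s, y) := by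
      rcases Nat.eq_zero_or_pos p with h2 | h2
      · refine bondOp_comm_of_type_eq hL (stepVec_injective hL ?_)
        have h3 : y + stepVec L s = w := hq.eq_of_pos_eq hσ h hy.next hw.ne_zero (by lia)
        have h4 : w - stepVec L t = y := hy.unique _ (hw.prev (by lia)) (by lia)
        rw [← sub_eq_of_eq_add' h3.symm, ← h4, sub_sub_cancel]
      · refine bondOp_comm_of_disjoint hL ?_ ?_ ?_ ?_ <;> intro h3 <;>
          have h4 := congrArg (pos a) h3 <;> simp only at h4 <;> lia
    have hBV : bondOp (!r, x) * bondOp (t, w) = bondOp (t, w) * bondOp (!r, x) := by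
      refine bondOp_comm_of_disjoint hL ?_ ?_ ?_ ?_ <;> intro h3 <;>
        have h4 := congrArg (pos a) h3 <;> simp only at h3 h4
      · lia
      · have h5 := hw.top_letter (by lia)
        have h6 := hx.unique (w + stepVec L (!t)) (by rw [h5]; exact bondLetter_ne_zero _) (by lia)
        rw [h3] at h6
        simpa using stepVec_injective hL (add_left_cancel h6)
      · lia
      · lia
    have hBb : bondOp (!r, x) * bondOp (s, y) = bondOp (s, y) * bondOp (!r, x) := by
      refine bondOp_comm_of_disjoint hL ?_ ?_ ?_ ?_ <;> intro h3 <;>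
        have h4 := congrArg (pos a) h3 <;> simp only at h4 <;> lia
    have hBM := hBanti.anticomm hL hM
    have hbM := hyanti.anticomm hL hM
    have hBB := bondOp_mul_self (!r, x)
    have hshift_overlap := hq.shift_overlap hσ hx hy hshift hM
    have hM' : IsPauli (bondOp (s, y) * (bondOp (!r, x) * M)) (shiftSpec x r y s σ) :=
      (hM.bondOp_mul (!r, x)).bondOp_mul (s, y)
    generalize hV : bondOp (t, w) = V at *
    generalize hb : bondOp (s, y) = b at *
    generalize hB : bondOp (!r, x) = B at *
    have hbot : opComm L b (V * M) = (2 : ℂ) • (V * (b * M)) := by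
      rw [opComm, two_smul, ← mul_assoc, hbV, mul_assoc V M b, mul_assoc V b M, hbM]
      noncomm_ring
    have htop' : opComm L B (V * (b * (B * M))) = (2 : ℂ) • (V * (b * M)) := by
      have h2 : B * (V * (b * (B * M))) = V * (b * M) := by
        rw [← mul_assoc B V, hBV, mul_assoc V B, ← mul_assoc B b, hBb, mul_assoc b B,
          ← mul_assoc B B, hBB, one_mul]
      have h3 : V * (b * (B * M)) * B = -(V * (b * M)) := by
        rw [mul_assoc V, mul_assoc b, mul_assoc B M, ← neg_eq_iff_eq_neg.mpr hBM, mul_neg,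
          ← mul_assoc B B, hBB, one_mul, mul_neg, mul_neg]
      rw [opComm, h2, h3, two_smul, sub_neg_eq_add]
    rw [hbot, overlap_smul] at h1
    refine ih (n + 1) (hq.shift_window hσ hx hy hshift) (hq.shift_ne_zero hσ hx hy h)
      (hq.turnAt_shift hσ hx hy h hw) hM' fun x' t' hx' => ?_
    have hx1 : x + stepVec L (!r) = x' := by
      refine hx'.unique _ ((hq.shift_support hσ hx hy hshift _).mpr (Or.inr rfl)) ?_
      have h2 := pos_add_one hL a (x + stepVec L (!r))
      lia
    have ht1 : t' = !r := by
      have h2 := hx'.letter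
      rw [← hx1, hq.shiftSpec_of_two_le_pos hy (by lia), hnew, bondLetter_inj] at h2
      exact h2.symm
    subst ht1 hx1
    rw [if_pos (by lia), add_sub_cancel_right, hB, htop', overlap_smul]
    refine mul_left_cancel₀ (hq.coupling_ne_zero s) ?_
    push_cast
    linear_combination J (!r) * h1 - 2 * (n + 1) * J t * hshift_overlap

/-- For `k ≥ 3` no Pauli product of diagonal length `k` contributes. -/
theorem eq_zero_of_three_le (hq : LocalCharge J k q) (hk : 3 ≤ k) (hσ : Window a k σ) :
    q σ = 0 := by
  by_contra h
  obtain ⟨y, s, hy⟩ := hq.exists_botAt hσ h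
  obtain ⟨x, t, hx⟩ := hq.exists_topAt hσ h
  refine hq.not_turnAt hk 0 (hq.shift_window hσ hx hy (hq.shift_anti hσ hx hy h))
    (hq.shift_ne_zero hσ hx hy h) (hq.turnAt_of_topAt hk hσ hx hy h) (isPauli_PauliOp _)
    fun x' t' _ => ?_
  rw [if_neg (by lia)]
  simp

end LocalCharge

end

section

variable {L : ℕ} [NeZero L]

theorem bondOp_mul_PauliOp (hL : 1 < L) {b : Bool × Site L} {τ : PSpec L} (h : BondAnti b τ) :
    ∃ z : ℂ, (z = Complex.I ∨ z = -Complex.I) ∧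
      bondOp b * PauliOp L τ = z • PauliOp L (bondMul b τ) := by
  have hne : b.2 ≠ b.2 + stepVec L b.1 := fun h =>
    stepVec_ne_zero hL b.1 (left_eq_add.mp h)
  refine ⟨_, ?_, PauliOp_mul _ _⟩
  rw [Finset.prod_eq_mul b.2 (b.2 + stepVec L b.1) hne]
  · have h1 : bondSpec b b.2 = bondLetter b.1 := by simp [bondSpec]
    have h2 : bondSpec b (b.2 + stepVec L b.1) = bondLetter b.1 := by simp [bondSpec]
    rw [h1, h2]
    unfold BondAnti at h
    by_cases h3 : LetterAnti (bondLetter b.1) (τ b.2)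
    · rw [letterPhase_of_not_anti (b := τ (b.2 + stepVec L b.1)) (by tauto), mul_one]
      exact letterPhase_of_anti h3
    · rw [letterPhase_of_not_anti h3, one_mul]
      exact letterPhase_of_anti (by tauto)
  · rintro v - ⟨h1, h2⟩
    exact letterPhase_of_not_anti (by simp [bondSpec, h1, h2, not_zero_letterAnti])
  · simp
  · simp

/-- The coefficient in the definition of the appended product when the last site is attached by
a bond of type `t`. -/
noncomputable def appendCoeff (t : Bool) : ℂ :=
  if t then -(1 / (2 * Complex.I)) else 1 / (2 * Complex.I)

theorem shiftRel_iff {k : ℕ} {σ σ' : PSpec L} (hk : 2 ≤ k) (hL : 1 < L) :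
    ShiftRel L k σ σ' ↔ Diag L σ = k ∧ σ' ≠ 0 ∧ ∃ a, Window a k σ ∧ ∃ x t y s,
      TopAt σ a k x t ∧ BotAt σ a y s ∧
        ∃ ε : ℂ, (ε = 1 / (2 * Complex.I) ∨ ε = -(1 / (2 * Complex.I))) ∧
          PauliOp L σ' = ε • opComm L (bondOp (s, y))
            (appendCoeff t • opComm L (bondOp (!t, x)) (PauliOp L σ)) := by
  have htop : ∀ {a x t}, (∀ v, IsTopRight L σ a k v ↔ v = x) → σ x = bondLetter t →
      σ (x - stepVec L t) ≠ 0 → TopAt σ a k x t := fun hx h1 h2 =>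
    ⟨h1, ((hx _).mpr rfl).2, h2, fun v hv hvk => (hx v).mp ⟨hv, hvk⟩⟩
  have hbot : ∀ {a y s}, (∀ v, IsBottomLeft L σ a v ↔ v = y) → σ y = bondLetter s →
      σ (y + stepVec L s) ≠ 0 → BotAt σ a y s := fun hy h1 h2 =>
    ⟨h1, ((hy _).mpr rfl).2, h2, fun v hv hvk => (hy v).mp ⟨hv, hvk⟩⟩
  refine and_congr_right fun hd => and_congr_right fun _ => exists_congr fun a => ⟨?_, ?_⟩
  · rintro ⟨ha, x, y, hx, hy, B, hB, ε, hε, hσ'⟩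
    refine ⟨window_of_diagBoundAt hL hk hd ha, ?_⟩
    obtain ⟨t, hxt, hB⟩ : ∃ t, TopAt σ a k x t ∧
        B = appendCoeff t • opComm L (bondOp (!t, x)) (PauliOp L σ) := by
      rcases hB with ⟨h1, h2, h3⟩ | ⟨h1, h2, h3⟩
      · exact ⟨true, htop hx h1 h2, h3⟩
      · exact ⟨false, htop hx h1 h2, h3⟩
    subst hB
    rcases hσ' with ⟨h1, h2, h3⟩ | ⟨h1, h2, h3⟩
    · exact ⟨x, t, y, true, hxt, hbot hy h1 h2, ε, hε, h3⟩
    · exact ⟨x, t, y, false, hxt, hbot hy h1 h2, ε, hε, h3⟩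
  · rintro ⟨hσ, x, t, y, s, hx, hy, ε, hε, hσ'⟩
    refine ⟨hσ.lt, x, y, fun v => ⟨fun h => hx.unique v h.1 h.2, ?_⟩,
      fun v => ⟨fun h => hy.unique v h.1 h.2, ?_⟩,
      appendCoeff t • opComm L (bondOp (!t, x)) (PauliOp L σ), ?_, ε, hε, ?_⟩
    · rintro rfl
      exact ⟨by rw [hx.letter]; exact bondLetter_ne_zero t, hx.pos_eq⟩
    · rintro rfl
      exact ⟨by rw [hy.letter]; exact bondLetter_ne_zero s, hy.pos_eq⟩
    · cases t
      · exact Or.inr ⟨hx.letter, hx.prev, rfl⟩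
      · exact Or.inl ⟨hx.letter, hx.prev, rfl⟩
    · cases s
      · exact Or.inr ⟨hy.letter, hy.next, hσ'⟩
      · exact Or.inl ⟨hy.letter, hy.next, hσ'⟩

theorem opComm_smul (c : ℂ) (A B : Op L) : opComm L A (c • B) = c • opComm L A B := by
  simp [opComm, smul_sub]

namespace LocalCharge

variable {J : Bool → ℂ} {k : ℕ} {q : PSpec L → ℂ} {a : ZMod L} {σ σ' : PSpec L} {x y : Site L}
  {t s : Bool}

/-- A contributing Pauli product has a Shiraishi shift. -/
theorem exists_shiftRel (hq : LocalCharge J k q) (hd : Diag L σ = k) (h : q σ ≠ 0) :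
    ∃ σ', ShiftRel L k σ σ' := by
  have hL := hq.one_lt
  obtain ⟨a, ha⟩ := exists_diagBoundAt σ
  rw [hd] at ha
  have hσ := window_of_diagBoundAt hL hq.two_le hd ha
  obtain ⟨y, s, hy⟩ := hq.exists_botAt hσ h
  obtain ⟨x, t, hx⟩ := hq.exists_topAt hσ h
  have hanti := hq.shift_anti hσ hx hy h
  have hanti' := (hq.extend_top_of_topAt hσ hx).2.2.2.2.1
  have hM := isPauli_PauliOp σ
  obtain ⟨z, hz, hzσ⟩ := bondOp_mul_PauliOp hL hanti'
  obtain ⟨z', hz', hzσ'⟩ := bondOp_mul_PauliOp hL hanti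
  have hne : shiftSpec x t y s σ ≠ 0 := fun h0 =>
    (hq.shift_support hσ hx hy hanti (x + stepVec L (!t))).mpr (Or.inr rfl) (by simp [h0])
  have key : opComm L (bondOp (s, y)) (appendCoeff t • opComm L (bondOp (!t, x)) (PauliOp L σ)) =
      (4 * appendCoeff t * z * z') • PauliOp L (shiftSpec x t y s σ) := by
    rw [opComm_of_anticomm (hanti'.anticomm hL hM), opComm_smul, opComm_smul,
      opComm_of_anticomm (hanti.anticomm hL (hM.bondOp_mul _)), hzσ, Matrix.mul_smul, hzσ']
    simp only [smul_smul, shiftSpec]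
    ring_nf
  obtain ⟨ε, hε, hε1⟩ : ∃ ε : ℂ, (ε = 1 / (2 * Complex.I) ∨ ε = -(1 / (2 * Complex.I))) ∧
      ε * (4 * appendCoeff t * z * z') = 1 := by
    have hI := Complex.I_mul_I
    have hcoeff : appendCoeff t = Complex.I / 2 ∨ appendCoeff t = -(Complex.I / 2) := by
      unfold appendCoeff
      split_ifs
      · left; field_simp; simp
      · right; field_simp; simp
    have hzz : z * z' = 1 ∨ z * z' = -1 := by
      rcases hz with rfl | rfl <;> rcases hz' with rfl | rfl <;> simp
    have h1 : 1 / (2 * Complex.I) = -(Complex.I / 2) := by field_simp; simp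
    rw [h1]
    rcases hcoeff with h2 | h2 <;> rcases hzz with h3 | h3 <;> rw [h2, mul_assoc _ z, h3]
    · exact ⟨_, Or.inl rfl, by linear_combination -hI⟩
    · exact ⟨_, Or.inr rfl, by linear_combination -hI⟩
    · exact ⟨_, Or.inr rfl, by linear_combination -hI⟩
    · exact ⟨_, Or.inl rfl, by linear_combination -hI⟩
  refine ⟨shiftSpec x t y s σ, (shiftRel_iff hq.two_le hL).mpr
    ⟨hd, hne, a, hσ, x, t, y, s, hx, hy, ε, hε, ?_⟩⟩
  rw [key, smul_smul, hε1, one_smul]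

theorem coeff_of_shiftRel (hq : LocalCharge J k q) (h : ShiftRel L k σ σ') :
    ∃ a, Window a k σ ∧ ∃ x t y s, TopAt σ a k x t ∧ BotAt σ a y s ∧
      (J s * q σ' = J (!t) * q σ ∨ J s * q σ' = -(J (!t) * q σ)) := by
  have hL := hq.one_lt
  obtain ⟨-, -, a, hσ, x, t, y, s, hx, hy, ε, hε, hσ'⟩ := (shiftRel_iff hq.two_le hL).mp h
  refine ⟨a, hσ, x, t, y, s, hx, hy, ?_⟩
  have hM := isPauli_PauliOp σ
  have hanti' := (hq.extend_top_of_topAt hσ hx).2.2.2.2.1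
  rw [opComm_of_anticomm (hanti'.anticomm hL hM), opComm_smul, opComm_smul] at hσ'
  have hanti : BondAnti (s, y) (bondMul (!t, x) σ) := by
    by_contra hn
    refine (isPauli_PauliOp σ').ne_zero ?_
    rw [hσ', opComm, commute_of_not_bondAnti hL hn (hM.bondOp_mul _)]
    simp
  rw [opComm_of_anticomm (hanti.anticomm hL (hM.bondOp_mul _))] at hσ'
  have h1 := congrArg (overlap q) hσ'
  have h2 := hq.shift_overlap hσ hx hy hanti hM
  simp only [overlap_smul, overlap_PauliOp] at h1 h2
  generalize overlap q (bondOp (s, y) * (bondOp (!t, x) * PauliOp L σ)) = d at h1 h2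
  have hN : (2 : ℂ) ^ Fintype.card (Site L) ≠ 0 := pow_ne_zero _ two_ne_zero
  have hη : ε * (appendCoeff t * (2 * 2)) = 1 ∨ ε * (appendCoeff t * (2 * 2)) = -1 := by
    have hI := Complex.I_mul_I
    have h3 : 1 / (2 * Complex.I) = -(Complex.I / 2) := by field_simp; simp
    unfold appendCoeff
    rw [h3] at hε ⊢
    split_ifs <;> rcases hε with rfl | rfl
    · left; linear_combination -hI
    · right; linear_combination hI
    · right; linear_combination hI
    · left; linear_combination -hI
  rcases hη with h3 | h3
  · right
    refine mul_left_cancel₀ hN ?_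
    linear_combination J s * h1 + h2 + J s * d * h3
  · left
    refine mul_left_cancel₀ hN ?_
    linear_combination J s * h1 - h2 + J s * d * h3

/-- The coefficient of the shift is the original coefficient times `± J (!t) / J t`. -/
theorem exists_coeff_eq_of_shiftRel (hq : LocalCharge J k q) (h : ShiftRel L k σ σ') :
    ∃ t, q σ' = J (!t) / J t * q σ ∨ q σ' = -(J (!t) / J t) * q σ := by
  obtain ⟨a, hσ, x, t, y, s, hx, hy, h1⟩ := hq.coeff_of_shiftRel h
  have hs := hq.coupling_ne_zero s
  rcases Nat.lt_or_ge 2 k with hk | hk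
  · have h2 := hq.eq_zero_of_three_le hk hσ
    refine ⟨t, Or.inl ?_⟩
    simpa [h2, hs] using h1
  · have hk2 := hq.two_le
    have hkL := hq.two_mul_le
    have hxp := hx.pos_eq
    have hyp := hy.pos_eq
    have h3 : x - stepVec L t = y := hy.unique _ hx.prev
      (by have := pos_sub_stepVec hq.one_lt a x t; lia)
    have h4 : y + stepVec L s = x := hx.unique _ hy.next
      (by have := pos_add_stepVec hq.one_lt a y s; lia)
    have h5 : s = t := stepVec_injective hq.one_lt
      (by rw [← sub_eq_of_eq_add' h4.symm, ← h3, sub_sub_cancel])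
    subst h5
    refine ⟨s, h1.imp (fun h => ?_) (fun h => ?_)⟩ <;> field_simp <;> linear_combination h

end LocalCharge

theorem Hcompass_eq (Jx Jy : ℝ) :
    Hcompass L Jx Jy =
      -∑ b : Bool × Site L, ((if b.1 then Jx else Jy : ℝ) : ℂ) • bondOp b := by
  rw [Hcompass, Finset.sum_add_distrib, Fintype.sum_prod_type (α₁ := Bool), Fintype.sum_bool]
  rfl

theorem localCharge_of_commute {Jx Jy : ℝ} (hJx : Jx ≠ 0) (hJy : Jy ≠ 0) {k : ℕ} (hk : 2 ≤ k)
    (hkL : 2 * k ≤ L) {q : PSpec L → ℂ} (hdiag : ∀ σ, q σ ≠ 0 → Diag L σ ≤ k)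
    (hcons : opComm L (Hcompass L Jx Jy) (Qop L q) = 0) :
    LocalCharge (fun t => ((if t then Jx else Jy : ℝ) : ℂ)) k q := by
  refine ⟨fun t => ?_, hk, hkL, hdiag, fun T => ?_⟩
  · cases t <;> simp [hJx, hJy]
  · rw [Hcompass_eq] at hcons
    set h := ∑ b : Bool × Site L, ((if b.1 then Jx else Jy : ℝ) : ℂ) • bondOp b with hh
    have hcomm : h * Qop L q = Qop L q * h := by
      rw [opComm, neg_mul, mul_neg, sub_neg_eq_add, neg_add_eq_zero] at hcons
      exact hcons
    have h1 : ∑ b : Bool × Site L, ((if b.1 then Jx else Jy : ℝ) : ℂ) *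
        overlap q (opComm L (bondOp b) T) = overlap q (opComm L h T) := by
      simp only [overlap, opComm, hh, Finset.sum_mul, Finset.mul_sum, sub_mul, Matrix.trace_sub,
        Matrix.trace_sum, Matrix.smul_mul, Matrix.mul_smul, Matrix.trace_smul, smul_eq_mul,
        mul_sub, Finset.sum_sub_distrib]
    rw [h1, overlap, opComm, sub_mul, Matrix.trace_sub, mul_assoc T h, hcomm, ← mul_assoc T,
      Matrix.trace_mul_comm (T * Qop L q) h, mul_assoc h T, sub_self]

end

/-- **Lemma 3 of the paper.** Let `2 ≤ k̄ ≤ L/2` and let `Q` be a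
local conserved quantity. For a Pauli product `σ` with `Diag σ = k̄`: if the
Shiraishi shift of `σ` does not exist, then `q_σ = 0`; if it exists, then
`q_{S(σ)} = λ q_σ` with a nonzero constant `λ ∈ {±Jy/Jx, ±Jx/Jy}`. -/
theorem shiraishi_shift_lemma
    (L : ℕ) [NeZero L] (Jx Jy : ℝ) (hJx : Jx ≠ 0) (hJy : Jy ≠ 0)
    (k : ℕ) (hk : 2 ≤ k) (hkL : 2 * k ≤ L)
    (q : PSpec L → ℂ)
    (hsupp : ∀ σ : PSpec L, q σ ≠ 0 → σ ≠ 0 ∧ Diag L σ ≤ k)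
    (hcons : opComm L (Hcompass L Jx Jy) (Qop L q) = 0)
    (σ : PSpec L) (hdiag : Diag L σ = k) :
    ((¬ ∃ σ' : PSpec L, ShiftRel L k σ σ') → q σ = 0) ∧
    (∀ σ' : PSpec L, ShiftRel L k σ σ' →
      ∃ l : ℂ, l ≠ 0 ∧
        (l = ((Jy / Jx : ℝ) : ℂ) ∨ l = -((Jy / Jx : ℝ) : ℂ) ∨
          l = ((Jx / Jy : ℝ) : ℂ) ∨ l = -((Jx / Jy : ℝ) : ℂ)) ∧
        q σ' = l * q σ) := by
  have hq := localCharge_of_commute hJx hJy hk hkL (fun τ h => (hsupp τ h).2) hcons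
  refine ⟨fun h => by_contra fun h0 => h (hq.exists_shiftRel hdiag h0), fun σ' h => ?_⟩
  obtain ⟨t, h1⟩ := hq.exists_coeff_eq_of_shiftRel h
  have hx : (Jx : ℂ) ≠ 0 := by exact_mod_cast hJx
  have hy : (Jy : ℂ) ≠ 0 := by exact_mod_cast hJy
  cases t <;> rcases h1 with h1 | h1 <;> refine ⟨_, ?_, ?_, h1⟩ <;> simp [hx, hy]
end

section
/- For the standard-form products, repeated Shiraishi shifts act as C^k_j = S^{j−1}(C^k_1) for j = 2,3,…; that is, the Shiraishi shift of C^k_j exists and equals C^k_{j+1} with the explicit Pauli assignments: for odd k, C^k_j has X at u_j, Z at u_{j+1},…,u_{j+k−2}, Y at u_{j+k−1} when j is odd, and Y at u_j, Z's in between, X at u_{j+k−1} when j is even; for even k, it has X at both ends when j is odd and Y at both ends when j is even. -/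
open Complex Matrix

section PauliProducts

variable {L : ℕ} [NeZero L]

theorem PauliOp_mul_apply (σ τ : PSpec L) (s t : Site L → Fin 2) :
    (PauliOp L σ * PauliOp L τ) s t = ∏ u, (pauli (σ u) * pauli (τ u)) (s u) (t u) := by
  simp only [Matrix.mul_apply, PauliOp, Finset.prod_univ_sum, Fintype.piFinset_univ,
    Finset.prod_mul_distrib]

/-- If two Pauli products multiply letter by letter to a third one, up to a scalar `p` at a single
site, then so do the operators. -/
theorem PauliOp_mul_eq_smul {σ τ ρ : PSpec L} {w : Site L} {p : ℂ}
    (hw : pauli (σ w) * pauli (τ w) = p • pauli (ρ w))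
    (h : ∀ v ≠ w, pauli (σ v) * pauli (τ v) = pauli (ρ v)) :
    PauliOp L σ * PauliOp L τ = p • PauliOp L ρ := by
  ext s t
  rw [PauliOp_mul_apply, Matrix.smul_apply, PauliOp, smul_eq_mul,
    ← Finset.mul_prod_erase _ _ (Finset.mem_univ w),
    ← Finset.mul_prod_erase _ (fun u => pauli (ρ u) (s u) (t u)) (Finset.mem_univ w), hw,
    Matrix.smul_apply, smul_eq_mul, mul_assoc]
  congr 2
  exact Finset.prod_congr rfl fun v hv => by rw [h v (Finset.ne_of_mem_erase hv)]

theorem pauli_zero : pauli 0 = 1 := by simp [pauli]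

theorem pauli_mul_self (a : Fin 4) : pauli a * pauli a = 1 := by
  fin_cases a <;> ext i j <;> fin_cases i <;> fin_cases j <;> simp [pauli, Matrix.mul_apply]

/-- The commutator of two Pauli products whose letters anticommute at exactly one site `w`, and
elsewhere are equal or include an identity. -/
theorem opComm_PauliOp {σ τ ρ : PSpec L} {w : Site L} {p : ℂ}
    (hw : pauli (σ w) * pauli (τ w) = p • pauli (ρ w))
    (hw' : pauli (τ w) * pauli (σ w) = (-p) • pauli (ρ w))
    (h : ∀ v ≠ w, (σ v = 0 ∧ ρ v = τ v) ∨ (τ v = 0 ∧ ρ v = σ v) ∨ (σ v = τ v ∧ ρ v = 0)) :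
    opComm L (PauliOp L σ) (PauliOp L τ) = (2 * p) • PauliOp L ρ := by
  have hmul : ∀ v ≠ w, pauli (σ v) * pauli (τ v) = pauli (ρ v) ∧
      pauli (τ v) * pauli (σ v) = pauli (ρ v) := by
    intro v hv
    rcases h v hv with ⟨h₁, h₂⟩ | ⟨h₁, h₂⟩ | ⟨h₁, h₂⟩ <;>
      simp [h₁, h₂, pauli_zero, pauli_mul_self]
  rw [opComm, PauliOp_mul_eq_smul hw fun v hv => (hmul v hv).1,
    PauliOp_mul_eq_smul hw' fun v hv => (hmul v hv).2, ← sub_smul]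
  congr 1
  ring

theorem pauli_one_mul_two : pauli 1 * pauli 2 = I • pauli 3 := by
  ext i j; fin_cases i <;> fin_cases j <;> simp [pauli, Matrix.mul_apply]

theorem pauli_two_mul_one : pauli 2 * pauli 1 = (-I) • pauli 3 := by
  ext i j; fin_cases i <;> fin_cases j <;> simp [pauli, Matrix.mul_apply]

theorem pauli_two_mul_three : pauli 2 * pauli 3 = I • pauli 1 := by
  ext i j; fin_cases i <;> fin_cases j <;> simp [pauli, Matrix.mul_apply]

theorem pauli_three_mul_two : pauli 3 * pauli 2 = (-I) • pauli 1 := by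
  ext i j; fin_cases i <;> fin_cases j <;> simp [pauli, Matrix.mul_apply]

theorem pauli_one_mul_three : pauli 1 * pauli 3 = (-I) • pauli 2 := by
  ext i j; fin_cases i <;> fin_cases j <;> simp [pauli, Matrix.mul_apply]

theorem pauli_three_mul_one : pauli 3 * pauli 1 = I • pauli 2 := by
  ext i j; fin_cases i <;> fin_cases j <;> simp [pauli, Matrix.mul_apply]

end PauliProducts

section Staircase

variable {L : ℕ} (u1 : Site L)

theorem stair_succ_of_odd {n : ℕ} (hn : n % 2 = 1) :
    stair L u1 (n + 1) = stair L u1 n + (1, 0) := by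
  obtain ⟨m, rfl⟩ : ∃ m, n = 2 * m + 1 := ⟨n / 2, by omega⟩
  have h₁ : (2 * m + 1 + 1) % 2 ≠ 1 := by omega
  have h₂ : (2 * m + 1 + 1) / 2 = m + 1 := by omega
  have h₃ : (2 * m + 1 - 1) / 2 = m := by omega
  ext <;> simp [stair, hn, h₁, h₂] <;> ring

theorem stair_succ_of_even {n : ℕ} (hn : n % 2 = 0) :
    stair L u1 (n + 1) = stair L u1 n + (0, 1) := by
  obtain ⟨m, rfl⟩ : ∃ m, n = 2 * m := ⟨n / 2, by omega⟩
  have h₁ : (2 * m + 1) % 2 = 1 := by omega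
  have h₂ : (2 * m + 1 - 1) / 2 = m := by omega
  ext <;> simp [stair, h₁]

theorem stair_add_diag (b d : ℕ) :
    (stair L u1 (b + d)).1 + (stair L u1 (b + d)).2 =
      (stair L u1 b).1 + (stair L u1 b).2 + (d : ZMod L) := by
  induction d with
  | zero => simp
  | succ d ih =>
    rw [← add_assoc, Nat.cast_succ]
    rcases Nat.mod_two_eq_zero_or_one (b + d) with h | h
    · rw [stair_succ_of_even u1 h, Prod.fst_add, Prod.snd_add]
      linear_combination ih
    · rw [stair_succ_of_odd u1 h, Prod.fst_add, Prod.snd_add]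
      linear_combination ih

theorem stair_diag_sub_val {b n : ℕ} (hbn : b ≤ n) (hn : n < b + L) :
    ((stair L u1 n).1 + (stair L u1 n).2 - ((stair L u1 b).1 + (stair L u1 b).2)).val = n - b := by
  obtain ⟨d, rfl⟩ := Nat.exists_eq_add_of_le hbn
  rw [stair_add_diag, add_sub_cancel_left, ZMod.val_natCast_of_lt (by omega), Nat.add_sub_cancel_left]

theorem stair_inj {b m n : ℕ} (hbm : b ≤ m) (hm : m < b + L) (hbn : b ≤ n) (hn : n < b + L) :
    stair L u1 m = stair L u1 n ↔ m = n := by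
  refine ⟨fun h => ?_, fun h => h ▸ rfl⟩
  have hm' := stair_diag_sub_val u1 hbm hm
  rw [h, stair_diag_sub_val u1 hbn hn] at hm'
  omega

theorem Cspec_eq_zero {k j : ℕ} (hk : 1 ≤ k) {v : Site L}
    (hv : ∀ n, j ≤ n → n < j + k → v ≠ stair L u1 n) : Cspec L k j u1 v = 0 := by
  have himg : v ∉ (Finset.Icc (j + 1) (j + k - 2)).image (stair L u1) := by
    rw [Finset.mem_image]
    rintro ⟨n, hn, rfl⟩
    rw [Finset.mem_Icc] at hn
    exact hv n (by omega) (by omega) rfl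
  rw [Cspec, if_neg (hv j le_rfl (by omega)), if_neg (hv (j + k - 1) (by omega) (by omega)),
    if_neg himg]

theorem Cspec_stair {k j b n : ℕ} (hk : 1 ≤ k) (hbj : b ≤ j) (hj : j + k ≤ b + L)
    (hbn : b ≤ n) (hn : n < b + L) :
    Cspec L k j u1 (stair L u1 n) =
      if n = j then endL j else if n = j + k - 1 then endR k j
      else if j < n ∧ n < j + k - 1 then 3 else 0 := by
  have himg : stair L u1 n ∈ (Finset.Icc (j + 1) (j + k - 2)).image (stair L u1) ↔
      j < n ∧ n < j + k - 1 := by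
    simp only [Finset.mem_image, Finset.mem_Icc]
    constructor
    · rintro ⟨m, hm, h⟩
      rw [stair_inj u1 (b := b) (by omega) (by omega) hbn hn] at h
      omega
    · exact fun h => ⟨n, by omega, rfl⟩
  simp only [Cspec, himg, stair_inj u1 hbn hn hbj (by omega : j < b + L),
    stair_inj u1 hbn hn (by omega : b ≤ j + k - 1) (by omega)]

theorem endL_ne_zero (j : ℕ) : endL j ≠ 0 := by
  unfold endL; split_ifs <;> decide

theorem endR_eq (k j : ℕ) : endR k j = if (j + k) % 2 = 1 then 1 else 2 := by
  unfold endR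
  split_ifs <;> first | rfl | omega

theorem endR_ne_zero (k j : ℕ) : endR k j ≠ 0 := by
  rw [endR_eq]; split_ifs <;> decide

theorem Cspec_stair_ne_zero {k j n : ℕ} (hk : 1 ≤ k) (hkL : k ≤ L) (hjn : j ≤ n) (hn : n < j + k) :
    Cspec L k j u1 (stair L u1 n) ≠ 0 := by
  rw [Cspec_stair u1 hk le_rfl (by omega) hjn (by omega)]
  split_ifs
  · exact endL_ne_zero j
  · exact endR_ne_zero k j
  · decide
  · omega

theorem exists_stair_of_Cspec_ne_zero {k j : ℕ} (hk : 1 ≤ k) {v : Site L}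
    (hv : Cspec L k j u1 v ≠ 0) : ∃ n, j ≤ n ∧ n < j + k ∧ v = stair L u1 n := by
  by_contra! h
  exact hv (Cspec_eq_zero u1 hk h)

theorem diagBoundAt_Cspec {k j : ℕ} (hk : 1 ≤ k) (hkL : k ≤ L) :
    DiagBoundAt L (Cspec L k j u1) ((stair L u1 j).1 + (stair L u1 j).2) k := by
  intro v hv
  obtain ⟨n, h₁, h₂, rfl⟩ := exists_stair_of_Cspec_ne_zero u1 hk hv
  rw [stair_diag_sub_val u1 h₁ (by omega)]
  omega

theorem isTopRight_Cspec_iff {k j : ℕ} (hk : 1 ≤ k) (hkL : k ≤ L) (v : Site L) :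
    IsTopRight L (Cspec L k j u1) ((stair L u1 j).1 + (stair L u1 j).2) k v ↔
      v = stair L u1 (j + k - 1) := by
  constructor
  · rintro ⟨hv, hd⟩
    obtain ⟨n, h₁, h₂, rfl⟩ := exists_stair_of_Cspec_ne_zero u1 hk hv
    rw [stair_diag_sub_val u1 h₁ (by omega)] at hd
    congr 1
    omega
  · rintro rfl
    refine ⟨Cspec_stair_ne_zero u1 hk hkL (by omega) (by omega), ?_⟩
    rw [stair_diag_sub_val u1 (by omega) (by omega)]
    omega

theorem isBottomLeft_Cspec_iff {k j : ℕ} (hk : 1 ≤ k) (hkL : k ≤ L) (v : Site L) :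
    IsBottomLeft L (Cspec L k j u1) ((stair L u1 j).1 + (stair L u1 j).2) v ↔
      v = stair L u1 j := by
  constructor
  · rintro ⟨hv, hd⟩
    obtain ⟨n, h₁, h₂, rfl⟩ := exists_stair_of_Cspec_ne_zero u1 hk hv
    rw [stair_diag_sub_val u1 h₁ (by omega)] at hd
    congr 1
    omega
  · rintro rfl
    exact ⟨Cspec_stair_ne_zero u1 hk hkL le_rfl (by omega), by simp⟩

/-- The two-site interaction linking the `n`-th and `(n+1)`-st sites of the staircase. -/
def stairBond (n : ℕ) : PSpec L := fun v =>
  if v = stair L u1 n then endL n else if v = stair L u1 (n + 1) then endL n else 0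

theorem sigXX_stair {n : ℕ} (hn : n % 2 = 1) : sigXX L (stair L u1 n) = stairBond u1 n := by
  funext v
  simp [sigXX, stairBond, stair_succ_of_odd u1 hn, endL, hn]

theorem sigYY_stair {n : ℕ} (hn : n % 2 = 0) : sigYY L (stair L u1 n) = stairBond u1 n := by
  funext v
  simp [sigYY, stairBond, stair_succ_of_even u1 hn, endL, hn]

theorem stairBond_stair {b m n : ℕ} (hbm : b ≤ m) (hm : m + 1 < b + L) (hbn : b ≤ n)
    (hn : n < b + L) :
    stairBond u1 m (stair L u1 n) = if n = m ∨ n = m + 1 then endL m else 0 := by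
  simp only [stairBond, stair_inj u1 hbn hn hbm (by omega : m < b + L),
    stair_inj u1 hbn hn (by omega : b ≤ m + 1) hm]
  split_ifs <;> first | rfl | omega

theorem stairBond_eq_zero {n : ℕ} {v : Site L} (h : v ≠ stair L u1 n)
    (h' : v ≠ stair L u1 (n + 1)) : stairBond u1 n v = 0 := by
  rw [stairBond, if_neg h, if_neg h']

variable [NeZero L]

/-- Appending a site to `C^k_j` at the top right. -/
theorem opComm_stairBond_append {k j : ℕ} (hk : 2 ≤ k) (hkL : k < L) :
    opComm L (PauliOp L (stairBond u1 (j + k - 1))) (PauliOp L (Cspec L k j u1)) =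
      (2 * if (j + k - 1) % 2 = 1 then I else -I) • PauliOp L (Cspec L (k + 1) j u1) := by
  have hτ {n : ℕ} (h₁ : j ≤ n) (h₂ : n ≤ j + k) := stairBond_stair u1 (b := j) (m := j + k - 1)
    (by omega) (by omega) h₁ (by omega)
  have hσ {n : ℕ} (h₁ : j ≤ n) (h₂ : n ≤ j + k) := Cspec_stair u1 (k := k) (j := j) (b := j)
    (by omega) le_rfl (by omega) h₁ (by omega)
  have hρ {n : ℕ} (h₁ : j ≤ n) (h₂ : n ≤ j + k) := Cspec_stair u1 (k := k + 1) (j := j) (b := j)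
    (by omega) le_rfl (by omega) h₁ (by omega)
  have hτw : stairBond u1 (j + k - 1) (stair L u1 (j + k - 1)) = endL (j + k - 1) := by
    rw [hτ (by omega) (by omega), if_pos (Or.inl rfl)]
  have hσw : Cspec L k j u1 (stair L u1 (j + k - 1)) = endR k j := by
    rw [hσ (by omega) (by omega), if_neg (by omega), if_pos rfl]
  have hρw : Cspec L (k + 1) j u1 (stair L u1 (j + k - 1)) = 3 := by
    rw [hρ (by omega) (by omega), if_neg (by omega), if_neg (by omega), if_pos (by omega)]
  refine opComm_PauliOp (w := stair L u1 (j + k - 1)) ?_ ?_ ?_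
  · rw [hτw, hσw, hρw, endR_eq, endL]
    rcases Nat.mod_two_eq_zero_or_one (j + k) with h | h
    · rw [if_pos (by omega), if_neg (by omega), if_pos (by omega), pauli_one_mul_two]
    · rw [if_neg (by omega), if_pos (by omega), if_neg (by omega), pauli_two_mul_one]
  · rw [hτw, hσw, hρw, endR_eq, endL]
    rcases Nat.mod_two_eq_zero_or_one (j + k) with h | h
    · rw [if_neg (by omega), if_pos (by omega), if_pos (by omega), pauli_two_mul_one]
    · rw [if_pos (by omega), if_neg (by omega), if_neg (by omega), pauli_one_mul_two, neg_neg]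
  · intro v hv
    by_cases hvn : ∃ n, j ≤ n ∧ n ≤ j + k ∧ v = stair L u1 n
    · obtain ⟨n, h₁, h₂, rfl⟩ := hvn
      have hne : n ≠ j + k - 1 := fun h => hv (h ▸ rfl)
      rw [hτ h₁ h₂, hσ h₁ h₂, hρ h₁ h₂, endR_eq (k + 1)]
      rcases eq_or_lt_of_le h₂ with rfl | h₃
      · refine Or.inr (Or.inl ⟨?_, ?_⟩)
        · rw [if_neg (by omega), if_neg (by omega), if_neg (by omega)]
        · rw [if_neg (by omega), if_pos (by omega), if_pos (Or.inr (by omega)), endL]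
          split_ifs <;> first | rfl | omega
      · refine Or.inl ⟨if_neg (by omega), ?_⟩
        split_ifs <;> first | rfl | omega
    · push Not at hvn
      refine Or.inl ⟨stairBond_eq_zero u1 (hvn _ (by omega) (by omega))
        (hvn _ (by omega) (by omega)), ?_⟩
      rw [Cspec_eq_zero u1 (by omega) fun n h₁ h₂ => hvn n h₁ (by omega),
        Cspec_eq_zero u1 (by omega) fun n h₁ h₂ => hvn n h₁ (by omega)]

/-- Removing the bottom-left site of `C^{k+1}_j`. -/
theorem opComm_stairBond_truncate {k j : ℕ} (hk : 2 ≤ k) (hkL : k < L) :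
    opComm L (PauliOp L (stairBond u1 j)) (PauliOp L (Cspec L (k + 1) j u1)) =
      (2 * if j % 2 = 1 then -I else I) • PauliOp L (Cspec L k (j + 1) u1) := by
  have hτ {n : ℕ} (h₁ : j ≤ n) (h₂ : n ≤ j + k) := stairBond_stair u1 (b := j) (m := j)
    le_rfl (by omega) h₁ (by omega)
  have hσ {n : ℕ} (h₁ : j ≤ n) (h₂ : n ≤ j + k) := Cspec_stair u1 (k := k + 1) (j := j) (b := j)
    (by omega) le_rfl (by omega) h₁ (by omega)
  have hρ {n : ℕ} (h₁ : j ≤ n) (h₂ : n ≤ j + k) := Cspec_stair u1 (k := k) (j := j + 1) (b := j)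
    (by omega) (by omega) (by omega) h₁ (by omega)
  have hτw : stairBond u1 j (stair L u1 (j + 1)) = endL j := by
    rw [hτ (by omega) (by omega), if_pos (Or.inr rfl)]
  have hσw : Cspec L (k + 1) j u1 (stair L u1 (j + 1)) = 3 := by
    rw [hσ (by omega) (by omega), if_neg (by omega), if_neg (by omega), if_pos (by omega)]
  have hρw : Cspec L k (j + 1) u1 (stair L u1 (j + 1)) = endL (j + 1) := by
    rw [hρ (by omega) (by omega), if_pos rfl]
  refine opComm_PauliOp (w := stair L u1 (j + 1)) ?_ ?_ ?_
  · rw [hτw, hσw, hρw, endL, endL]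
    rcases Nat.mod_two_eq_zero_or_one j with h | h
    · rw [if_neg (by omega), if_neg (by omega), if_pos (by omega), pauli_two_mul_three]
    · rw [if_pos h, if_pos h, if_neg (by omega), pauli_one_mul_three]
  · rw [hτw, hσw, hρw, endL, endL]
    rcases Nat.mod_two_eq_zero_or_one j with h | h
    · rw [if_neg (by omega), if_neg (by omega), if_pos (by omega), pauli_three_mul_two]
    · rw [if_pos h, if_pos h, if_neg (by omega), pauli_three_mul_one, neg_neg]
  · intro v hv
    by_cases hvn : ∃ n, j ≤ n ∧ n ≤ j + k ∧ v = stair L u1 n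
    · obtain ⟨n, h₁, h₂, rfl⟩ := hvn
      have hne : n ≠ j + 1 := fun h => hv (h ▸ rfl)
      rw [hτ h₁ h₂, hσ h₁ h₂, hρ h₁ h₂, endR_eq, endR_eq]
      rcases eq_or_lt_of_le h₁ with rfl | h₃
      · refine Or.inr (Or.inr ⟨?_, ?_⟩)
        · rw [if_pos (Or.inl rfl), if_pos rfl]
        · rw [if_neg (by omega), if_neg (by omega), if_neg (by omega)]
      · refine Or.inl ⟨if_neg (by omega), ?_⟩
        split_ifs <;> first | rfl | omega
    · push Not at hvn
      refine Or.inl ⟨stairBond_eq_zero u1 (hvn _ (by omega) (by omega))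
        (hvn _ (by omega) (by omega)), ?_⟩
      rw [Cspec_eq_zero u1 (by omega) fun n h₁ h₂ => hvn n (by omega) (by omega),
        Cspec_eq_zero u1 (by omega) fun n h₁ h₂ => hvn n h₁ (by omega)]

theorem Diag_Cspec {k j : ℕ} (hk : 1 ≤ k) (hkL : k ≤ L) : Diag L (Cspec L k j u1) = k := by
  refine le_antisymm (Nat.sInf_le ⟨_, diagBoundAt_Cspec u1 hk hkL⟩)
    (le_csInf ⟨k, _, diagBoundAt_Cspec u1 hk hkL⟩ ?_)
  rintro m ⟨a, ha⟩
  rw [← Finset.card_range k, ← Finset.card_range m]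
  refine Finset.card_le_card_of_injOn
    (fun d => ((stair L u1 (j + d)).1 + (stair L u1 (j + d)).2 - a).val) ?_ ?_
  · intro d hd
    have hd' : d < k := by simpa using hd
    simpa using ha _ (Cspec_stair_ne_zero u1 hk hkL (by omega) (by omega : j + d < j + k))
  · intro d hd e he h
    have hd' : d < k := by simpa using hd
    have he' : e < k := by simpa using he
    have h' := ZMod.val_injective L h
    rw [stair_add_diag, stair_add_diag, sub_left_inj, add_right_inj] at h'
    have := congrArg ZMod.val h'
    rwa [ZMod.val_natCast_of_lt (by omega), ZMod.val_natCast_of_lt (by omega)] at this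

end Staircase

/-- Repeated Shiraishi shifts act on the standard-form
products as `C^k_j = S^{j−1}(C^k_1)`: the Shiraishi shift of `C^k_j` exists
and equals `C^k_{j+1}`. -/
theorem shiraishi_shift_of_standard_form
    (L : ℕ) [NeZero L] (k j : ℕ) (hk : 2 ≤ k) (hkL : 2 * k ≤ L)
    (hj : 1 ≤ j) (hjk : j + k - 1 ≤ L) (u1 : Site L) :
    ShiftRel L k (Cspec L k j u1) (Cspec L k (j + 1) u1) := by
  have hk1 : 1 ≤ k := by omega
  have hkL' : k < L := by omega
  have hne {n : ℕ} (h₁ : j ≤ n) (h₂ : n < j + k) :=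
    Cspec_stair_ne_zero u1 hk1 hkL'.le h₁ h₂
  refine ⟨Diag_Cspec u1 hk1 hkL'.le, fun h => ?_, _, diagBoundAt_Cspec u1 hk1 hkL'.le,
    stair L u1 (j + k - 1), stair L u1 j, isTopRight_Cspec_iff u1 hk1 hkL'.le,
    isBottomLeft_Cspec_iff u1 hk1 hkL'.le, PauliOp L (Cspec L (k + 1) j u1), ?_, ?_⟩
  · exact Cspec_stair_ne_zero u1 hk1 hkL'.le le_rfl (by omega : j + 1 < j + 1 + k) (congrFun h _)
  · have hB := opComm_stairBond_append u1 (j := j) hk hkL'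
    have hub : Cspec L k j u1 (stair L u1 (j + k - 1)) = endR k j := by
      rw [Cspec_stair u1 hk1 le_rfl (by omega) (by omega) (by omega), if_neg (by omega),
        if_pos rfl]
    have hsucc : j + k - 1 = j + k - 2 + 1 := by omega
    have hprev := hne (n := j + k - 2) (by omega) (by omega)
    rw [endR_eq] at hub
    rcases Nat.mod_two_eq_zero_or_one (j + k) with h | h
    · refine Or.inr ⟨by rw [hub, if_neg (by omega)], ?_, ?_⟩
      · rwa [hsucc, stair_succ_of_even u1 (by omega), add_sub_cancel_right]
      · rw [sigXX_stair u1 (by omega), hB, if_pos (by omega), smul_smul,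
          one_div_mul_cancel (by simp), one_smul]
    · refine Or.inl ⟨by rw [hub, if_pos h], ?_, ?_⟩
      · rwa [hsucc, stair_succ_of_odd u1 (by omega), add_sub_cancel_right]
      · rw [sigYY_stair u1 (by omega), hB, if_neg (by omega), smul_smul, mul_neg, neg_mul_neg,
          one_div_mul_cancel (by simp), one_smul]
  · have hT := opComm_stairBond_truncate u1 (j := j) hk hkL'
    have hlb : Cspec L k j u1 (stair L u1 j) = endL j := by
      rw [Cspec_stair u1 hk1 le_rfl (by omega) le_rfl (by omega), if_pos rfl]
    have hnext := hne (n := j + 1) (by omega) (by omega)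
    rw [endL] at hlb
    rcases Nat.mod_two_eq_zero_or_one j with h | h
    · refine ⟨_, Or.inl rfl, Or.inr ⟨by rw [hlb, if_neg (by omega)], ?_, ?_⟩⟩
      · rwa [← stair_succ_of_even u1 h]
      · rw [sigYY_stair u1 h, hT, if_neg (by omega), smul_smul, one_div_mul_cancel (by simp),
          one_smul]
    · refine ⟨_, Or.inr rfl, Or.inl ⟨by rw [hlb, if_pos h], ?_, ?_⟩⟩
      · rwa [← stair_succ_of_odd u1 h]
      · rw [sigXX_stair u1 h, hT, if_pos h, smul_smul, mul_neg, neg_mul_neg,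
          one_div_mul_cancel (by simp), one_smul]
end
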